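/- arXiv:1505.05827 — 5 statements merged into one kernel-verified Lean document; each statement's English description precedes it below -/
import Mathlib

section
/- Let U ⊆ ℝ^{2n} be open, let B : U → M_{2n}(ℝ) be a C¹ structure matrix, and let H : U → ℝ be of class C². Define f : U → ℝ^{2n} by f(z) = B(z)∇H(z) and let a(z) = Df(z) be its Jacobian matrix. Then for every z ∈ U, a(z)B(z) + B(z)a(z)^T = DB(z)[B(z)∇H(z)], where for v ∈ ℝ^{2n}, DB(z)[v] denotes the matrix with entries (DB(z)[v])_{ij} = Σ_{l=1}^{2n} (∂b_{ij}/∂z_l)(z) v_l. -/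
open Matrix

/-- The gradient of `H : ℝ^d → ℝ`, with entries `∂H/∂z_i`. -/
noncomputable def pgrad {d : ℕ} (H : (Fin d → ℝ) → ℝ) (z : Fin d → ℝ) : Fin d → ℝ :=
  fun i => fderiv ℝ H z (Pi.single i 1)

/-- The Jacobian matrix of `f : ℝ^a → ℝ^b`, with entries `∂f_i/∂z_j`. -/
noncomputable def pjac {a b : ℕ} (f : (Fin a → ℝ) → (Fin b → ℝ)) (z : Fin a → ℝ) :
    Matrix (Fin b) (Fin a) ℝ :=
  Matrix.of fun i j => fderiv ℝ f z (Pi.single j 1) i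

/-- The partial derivatives of `z ↦ B(z)∇H(z)`, by the product rule. -/
theorem pjac_mulVec_pgrad_apply {d : ℕ} (B : (Fin d → ℝ) → Matrix (Fin d) (Fin d) ℝ)
    (H : (Fin d → ℝ) → ℝ) (z : Fin d → ℝ)
    (hB : ∀ i j, DifferentiableAt ℝ (fun w => B w i j) z)
    (hH : DifferentiableAt ℝ (fderiv ℝ H) z) (i l : Fin d) :
    pjac (fun w => (B w).mulVec (pgrad H w)) z i l
      = ∑ m, (fderiv ℝ (fun w => B w i m) z (Pi.single l 1) * pgrad H z m
          + B z i m * fderiv ℝ (fderiv ℝ H) z (Pi.single l 1) (Pi.single m 1)) := by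
  have hgrad (m : Fin d) : HasFDerivAt (fun w => pgrad H w m)
      ((fderiv ℝ (fderiv ℝ H) z).flip (Pi.single m 1)) z := by
    have h := hH.hasFDerivAt.clm_apply (hasFDerivAt_const (Pi.single m (1 : ℝ)) z)
    refine h.congr_fderiv ?_
    ext v
    simp
  have hf : HasFDerivAt (fun w => (B w).mulVec (pgrad H w))
      (ContinuousLinearMap.pi fun k => ∑ m,
        (B z k m • (fderiv ℝ (fderiv ℝ H) z).flip (Pi.single m 1)
          + pgrad H z m • fderiv ℝ (fun w => B w k m) z)) z := by
    rw [hasFDerivAt_pi]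
    intro k
    simp only [Matrix.mulVec, dotProduct]
    exact HasFDerivAt.fun_sum fun m _ => (hB k m).hasFDerivAt.fun_mul (hgrad m)
  simp only [pjac, Matrix.of_apply, hf.fderiv, ContinuousLinearMap.pi_apply,
    _root_.sum_apply, _root_.add_apply,
    _root_.smul_apply, ContinuousLinearMap.flip_apply, smul_eq_mul]
  exact Finset.sum_congr rfl fun m _ => by ring

/-- A linear functional on `ℝ^d` evaluated through the standard basis. -/
theorem clm_apply_eq_sum_single {d : ℕ} (L : (Fin d → ℝ) →L[ℝ] ℝ) (v : Fin d → ℝ) :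
    L v = ∑ l, L (Pi.single l 1) * v l := by
  conv_lhs => rw [pi_eq_sum_univ' v, map_sum]
  refine Finset.sum_congr rfl fun l _ => ?_
  rw [map_smul, smul_eq_mul, mul_comm]

/-- For a `C¹` structure matrix `B` (skew-symmetric, Jacobi identity)
and a `C²` Hamiltonian `H` on an open set `U ⊆ ℝ^{2n}`, the Jacobian `a(z) = Df(z)` of
the Hamiltonian vector field `f(z) = B(z)∇H(z)` satisfies
`a(z)B(z) + B(z)a(z)ᵀ = DB(z)[B(z)∇H(z)]` on `U`. -/
theorem stmt_3 {n : ℕ} (U : Set (Fin (2 * n) → ℝ)) (hU : IsOpen U)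
    (B : (Fin (2 * n) → ℝ) → Matrix (Fin (2 * n)) (Fin (2 * n)) ℝ)
    (hB : ∀ i j, ContDiffOn ℝ 1 (fun z => B z i j) U)
    (hskew : ∀ z ∈ U, ∀ i j, B z i j = - B z j i)
    (hjacobi : ∀ z ∈ U, ∀ i j k,
      ∑ l, (fderiv ℝ (fun w => B w i j) z (Pi.single l 1) * B z l k
          + fderiv ℝ (fun w => B w j k) z (Pi.single l 1) * B z l i
          + fderiv ℝ (fun w => B w k i) z (Pi.single l 1) * B z l j) = 0)
    (H : (Fin (2 * n) → ℝ) → ℝ) (hH : ContDiffOn ℝ 2 H U) :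
    ∀ z ∈ U,
      pjac (fun w => (B w).mulVec (pgrad H w)) z * B z
          + B z * (pjac (fun w => (B w).mulVec (pgrad H w)) z)ᵀ
        = Matrix.of fun i j =>
            fderiv ℝ (fun w => B w i j) z ((B z).mulVec (pgrad H z)) := by
  intro z hz
  have hUz : U ∈ nhds z := hU.mem_nhds hz
  have hBd (i j) : DifferentiableAt ℝ (fun w => B w i j) z :=
    ((hB i j).contDiffAt hUz).differentiableAt (by norm_num)
  have hHz : ContDiffAt ℝ 2 H z := hH.contDiffAt hUz
  have hHd : DifferentiableAt ℝ (fderiv ℝ H) z :=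
    (hHz.fderiv_right (m := 1) (by norm_num)).differentiableAt (by norm_num)
  have hsymm (v w) : fderiv ℝ (fderiv ℝ H) z v w = fderiv ℝ (fderiv ℝ H) z w v :=
    (hHz.isSymmSndFDerivAt (by simp)) v w
  have hdskew (i j) : fderiv ℝ (fun w => B w i j) z = -fderiv ℝ (fun w => B w j i) z := by
    rw [← fderiv_fun_neg]
    refine Filter.EventuallyEq.fderiv_eq ?_
    filter_upwards [hUz] with w hw using hskew w hw i j
  ext i j
  simp only [Matrix.add_apply, Matrix.mul_apply, Matrix.transpose_apply, Matrix.of_apply,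
    pjac_mulVec_pgrad_apply B H z hBd hHd]
  rw [clm_apply_eq_sum_single]
  simp only [Matrix.mulVec, dotProduct]
  have hhess : ∑ l, ∑ m, B z i m * fderiv ℝ (fderiv ℝ H) z (Pi.single l 1) (Pi.single m 1)
        * B z l j
      = -∑ l, ∑ m, B z i l *
        (B z j m * fderiv ℝ (fderiv ℝ H) z (Pi.single l 1) (Pi.single m 1)) := by
    rw [Finset.sum_comm, ← Finset.sum_neg_distrib]
    refine Finset.sum_congr rfl fun l _ => ?_
    rw [← Finset.sum_neg_distrib]
    refine Finset.sum_congr rfl fun m _ => ?_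
    rw [hskew z hz m j, hsymm]
    ring
  have hjac : ∑ l, ∑ m, (fderiv ℝ (fun w => B w i m) z (Pi.single l 1) * pgrad H z m * B z l j
      + B z i l * (fderiv ℝ (fun w => B w j m) z (Pi.single l 1) * pgrad H z m)
      - fderiv ℝ (fun w => B w i j) z (Pi.single l 1) * (B z l m * pgrad H z m)) = 0 := by
    rw [Finset.sum_comm]
    refine Finset.sum_eq_zero fun m _ => ?_
    have h := congrArg (fun x => -pgrad H z m * x) (hjacobi z hz m i j)
    simp only [mul_zero, Finset.mul_sum] at h
    rw [← h]
    refine Finset.sum_congr rfl fun l _ => ?_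
    rw [hskew z hz i l, hdskew i m, _root_.neg_apply]
    ring
  simp only [Finset.sum_mul, Finset.mul_sum, add_mul, mul_add, Finset.sum_add_distrib,
    Finset.sum_sub_distrib] at hhess hjac ⊢
  linarith
end

section
/- Let U ⊆ ℝ^{2n} be open, let B : U → M_{2n}(ℝ) be a C^∞ structure matrix with B(z) invertible for every z ∈ U, let H : U → ℝ be C^∞, and suppose there exists a C^∞ map c : U → ℝ^{2n} with B(z)^{-1} = Dc(z)^T − Dc(z) for all z ∈ U, where (Dc(z))_{ij} = ∂c_i/∂z_j. Let γ > 0, σ > 0, and let ω ∈ ℝ^n be (γ,σ)-Diophantine. Let K : ℝ^n → U be C^∞, ℤ^n-periodic, and satisfy ∂_ω K(θ) = B(K(θ))∇H(K(θ)) for all θ ∈ ℝ^n. Then DK(θ)^T B(K(θ))^{-1} DK(θ) = 0 for all θ ∈ ℝ^n; that is, the invariant torus K(ℝ^n/ℤ^n) is Lagrangian for the symplectic form Ω_z(ξ,η) = ⟨ξ, B(z)^{-1}η⟩. -/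
open Matrix

/-- `ω ∈ ℝⁿ` is `(γ, σ)`-Diophantine: `|k ⬝ ω| ≥ γ |k|^{-σ}` for all nonzero `k ∈ ℤⁿ`,
where `|k| = |k₁| + ⋯ + |kₙ|`. -/
def IsDiophantine {n : ℕ} (γ σ : ℝ) (ω : Fin n → ℝ) : Prop :=
  ∀ k : Fin n → ℤ, k ≠ 0 →
    γ * (∑ i, |(k i : ℝ)|) ^ (-σ) ≤ |∑ i, (k i : ℝ) * ω i|

/-- The map `ℝⁿ → (ℝ/ℤ)ⁿ` is an open quotient map. -/
lemma isOpenQuotientMap_coe_unitAddTorus {ι : Type*} [Fintype ι] :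
    IsOpenQuotientMap (fun (θ : ι → ℝ) (i : ι) => ((θ i : ℝ) : UnitAddCircle)) :=
  IsOpenQuotientMap.piMap (f := fun (_ : ι) (x : ℝ) => (x : UnitAddCircle))
    fun _ => QuotientAddGroup.isOpenQuotientMap_mk

/-- A continuous function on the torus whose nonzero Fourier coefficients vanish is constant. -/
lemma UnitAddTorus.eq_mFourierCoeff_zero {ι : Type*} [Fintype ι] (F : C(UnitAddTorus ι, ℂ))
    (hF : ∀ k : ι → ℤ, k ≠ 0 → mFourierCoeff F k = 0) (x : UnitAddTorus ι) :
    F x = mFourierCoeff F 0 := by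
  have hs : Summable (mFourierCoeff F) :=
    summable_of_ne_finset_zero (s := {0}) fun k hk => hF k (by simpa using hk)
  have h := hasSum_mFourier_series_apply_of_summable hs x
  have h0 := hasSum_single (f := fun k => mFourierCoeff F k • mFourier k x) 0
    (fun k hk => by simp [hF k hk])
  simpa [mFourier_zero] using h.unique h0

lemma UnitAddTorus.mFourier_apply_add {ι : Type*} [Fintype ι] (k : ι → ℤ)
    (x y : UnitAddTorus ι) : mFourier k (x + y) = mFourier k x * mFourier k y := by
  simp only [mFourier, ContinuousMap.coe_mk, ← Finset.prod_mul_distrib]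
  refine Finset.prod_congr rfl fun i _ => ?_
  simp [fourier_apply, AddCircle.toCircle_add]

lemma UnitAddTorus.mFourier_coe_apply {ι : Type*} [Fintype ι] (k : ι → ℤ) (θ : ι → ℝ) :
    mFourier k (fun i => (θ i : UnitAddCircle)) =
      Complex.exp (2 * Real.pi * Complex.I * ((∑ i, (k i : ℝ) * θ i : ℝ) : ℂ)) := by
  simp only [mFourier, ContinuousMap.coe_mk, fourier_coe_apply, ← Complex.exp_sum]
  congr 1
  push_cast
  rw [Finset.mul_sum]
  refine Finset.sum_congr rfl fun i _ => ?_
  simp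
  ring

/-- Translating a function multiplies its Fourier coefficients by a character. -/
lemma UnitAddTorus.mFourierCoeff_translate {ι : Type*} [Fintype ι] (F : UnitAddTorus ι → ℂ)
    (y : UnitAddTorus ι) (k : ι → ℤ) :
    mFourierCoeff (fun x => F (x + y)) k = mFourier k y * mFourierCoeff F k := by
  let μ : MeasureTheory.Measure (UnitAddTorus ι) :=
    MeasureTheory.Measure.pi fun _ => AddCircle.haarAddCircle
  have hμ (G : UnitAddTorus ι → ℂ) :
      mFourierCoeff G k = ∫ t, mFourier (-k) t • G t ∂μ := rfl
  have hone : mFourier k y * mFourier (-k) y = 1 := by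
    rw [← mFourier_add, add_neg_cancel, mFourier_zero]; rfl
  rw [hμ, hμ, ← MeasureTheory.integral_const_mul,
    ← MeasureTheory.integral_add_right_eq_self (μ := μ)
      (fun t => mFourier k y * (mFourier (-k) t • F t)) y]
  refine MeasureTheory.integral_congr_ae (Filter.Eventually.of_forall fun t => ?_)
  simp only [mFourier_apply_add, smul_eq_mul]
  linear_combination (-(mFourier (-k) t * F (t + y))) * hone

/-- A continuous periodic function invariant under a nonresonant linear flow is constant. -/
lemma eq_of_periodic_of_flow_invariant {n : ℕ} {ω : Fin n → ℝ}
    (hω : ∀ k : Fin n → ℤ, k ≠ 0 → ∑ i, (k i : ℝ) * ω i ≠ 0)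
    {f : (Fin n → ℝ) → ℝ} (hf : Continuous f)
    (hper : ∀ (θ : Fin n → ℝ) (k : Fin n → ℤ), f (θ + fun i => (k i : ℝ)) = f θ)
    (hinv : ∀ (θ : Fin n → ℝ) (t : ℝ), f (θ + t • ω) = f θ) (θ θ' : Fin n → ℝ) :
    f θ = f θ' := by
  have hq := (isOpenQuotientMap_coe_unitAddTorus (ι := Fin n)).isQuotientMap
  let π : C(Fin n → ℝ, UnitAddTorus (Fin n)) := ⟨_, hq.continuous⟩
  let g : C(Fin n → ℝ, ℂ) := ⟨fun x => (f x : ℂ), by fun_prop⟩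
  have hfac : Function.FactorsThrough g π := by
    intro a b hab
    have h1 : ∀ i, ∃ m : ℤ, (m : ℝ) = a i - b i := fun i => by
      have := (QuotientAddGroup.eq_iff_sub_mem.1 (congrFun hab i))
      obtain ⟨m, hm⟩ := AddSubgroup.mem_zmultiples_iff.1 this
      exact ⟨m, by simpa using hm⟩
    choose m hm using h1
    have : a = b + fun i => (m i : ℝ) := by ext i; simp [hm]
    simp [g, this, hper]
  let F := Topology.IsQuotientMap.lift (f := π) hq g hfac
  have hF (x : Fin n → ℝ) : F (π x) = f x := 
    DFunLike.congr_fun (Topology.IsQuotientMap.lift_comp (f := π) hq g hfac) x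
  have hcoeff (k : Fin n → ℤ) (hk : k ≠ 0) : UnitAddTorus.mFourierCoeff F k = 0 := by
    set s := ∑ i, (k i : ℝ) * ω i with hs
    have hs0 : s ≠ 0 := hω k hk
    have htr : (fun x => F (x + π ((1 / (2 * s)) • ω))) = F := by
      funext x
      obtain ⟨x, rfl⟩ := hq.surjective x
      have : π x + π ((1 / (2 * s)) • ω) = π (x + (1 / (2 * s)) • ω) := by
        ext i; simp [π]
      change F (π x + _) = F (π x)
      rw [this, hF, hF, hinv]
    have hchar : UnitAddTorus.mFourier k (π ((1 / (2 * s)) • ω)) = -1 := by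
      refine (UnitAddTorus.mFourier_coe_apply k _).trans ?_
      have : ∑ i, (k i : ℝ) * ((1 / (2 * s)) • ω) i = 1 / 2 := by
        simp only [Pi.smul_apply, smul_eq_mul, mul_left_comm _ (1 / (2 * s)), ← Finset.mul_sum,
          ← hs]
        field_simp
      rw [this, ← Complex.exp_pi_mul_I]
      congr 1
      push_cast
      ring
    have h := UnitAddTorus.mFourierCoeff_translate F (π ((1 / (2 * s)) • ω)) k
    rw [htr, hchar] at h
    have : (2 : ℂ) * UnitAddTorus.mFourierCoeff F k = 0 := by linear_combination h
    simpa using this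
  have h := UnitAddTorus.eq_mFourierCoeff_zero F hcoeff
  exact_mod_cast (hF θ).symm.trans ((h (π θ)).trans ((h (π θ')).symm.trans (hF θ')))

/-- If `∂_u p - ∂_v q` is a constant `C`, where `p` and `q` are invariant under translation by
`u` and `v`, then `C = 0`. -/
lemma const_eq_zero_of_fderiv_sub_fderiv {E : Type*} [NormedAddCommGroup E] [NormedSpace ℝ E]
    {p q : E → ℝ} (hp : Differentiable ℝ p) (hq : Differentiable ℝ q) {u v : E}
    (hpu : ∀ x, p (x + u) = p x) (hqv : ∀ x, q (x + v) = q x) {C : ℝ}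
    (hC : ∀ x, fderiv ℝ p x u - fderiv ℝ q x v = C) : C = 0 := by
  let A : ℝ × ℝ →L[ℝ] E :=
    (ContinuousLinearMap.fst ℝ ℝ ℝ).smulRight u + (ContinuousLinearMap.snd ℝ ℝ ℝ).smulRight v
  have hA (x y : ℝ) : A (x, y) = x • u + y • v := by simp [A]
  have hdp (z : ℝ × ℝ) : HasFDerivAt (fun z => p (A z)) ((fderiv ℝ p (A z)).comp A) z :=
    (hp (A z)).hasFDerivAt.comp z A.hasFDerivAt
  have hdq (z : ℝ × ℝ) : HasFDerivAt (fun z => -q (A z)) (-(fderiv ℝ q (A z)).comp A) z :=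
    ((hq (A z)).hasFDerivAt.comp z A.hasFDerivAt).neg
  have hsum (z : ℝ × ℝ) : ((fderiv ℝ p (A z)).comp A) (1, 0)
      + (-(fderiv ℝ q (A z)).comp A) (0, 1) = C := by
    simp [hA, ← hC (A z), sub_eq_add_neg]
  have h := MeasureTheory.integral2_divergence_prod_of_hasFDerivAt
    (fun z => p (A z)) (fun z => -q (A z)) (fun z => (fderiv ℝ p (A z)).comp A)
    (fun z => -(fderiv ℝ q (A z)).comp A) 0 0 1 1
    (fun z _ => (hdp z).continuousAt.continuousWithinAt)
    (fun z _ => (hdq z).continuousAt.continuousWithinAt)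
    (fun z _ => hdp z) (fun z _ => hdq z)
    (by simp only [hsum]
        exact continuousOn_const.integrableOn_compact (isCompact_uIcc.prod isCompact_uIcc))
  simp only [hsum] at h
  have hp1 (y : ℝ) : p (A (1, y)) = p (A (0, y)) := by
    rw [← hpu (A (0, y)), hA, hA]; congr 1; module
  have hq1 (x : ℝ) : q (A (x, 1)) = q (A (x, 0)) := by
    rw [← hqv (A (x, 0)), hA, hA]; congr 1; module
  simpa [hp1, hq1] using h

/-- A periodic one-form whose exterior derivative, contracted with a nonresonant constant
vector field, is exact must be closed. -/
lemma closed_of_contraction_exact {n : ℕ} {ω : Fin n → ℝ}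
    (hω : ∀ k : Fin n → ℤ, k ≠ 0 → ∑ i, (k i : ℝ) * ω i ≠ 0)
    {α : (Fin n → ℝ) → (Fin n → ℝ) →L[ℝ] ℝ} (hα : ContDiff ℝ 2 α)
    {h : (Fin n → ℝ) → ℝ} (hh : ContDiff ℝ 2 h)
    (hper : ∀ (θ : Fin n → ℝ) (k : Fin n → ℤ), α (θ + fun i => (k i : ℝ)) = α θ)
    (hex : ∀ θ u, fderiv ℝ α θ u ω - fderiv ℝ α θ ω u = fderiv ℝ h θ u)
    (θ : Fin n → ℝ) (i j : Fin n) :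
    fderiv ℝ α θ (Pi.single i 1) (Pi.single j 1) =
      fderiv ℝ α θ (Pi.single j 1) (Pi.single i 1) := by
  have hdα : Differentiable ℝ α := hα.differentiable (by norm_num)
  have hα' : ContDiff ℝ 1 (fderiv ℝ α) := hα.fderiv_right (by norm_num)
  have hdα' : Differentiable ℝ (fderiv ℝ α) := hα'.differentiable (by norm_num)
  have hdh' : Differentiable ℝ (fderiv ℝ h) :=
    (hh.fderiv_right (m := 1) (by norm_num)).differentiable (by norm_num)
  have happ (u v θ : Fin n → ℝ) :
      HasFDerivAt (fun θ => fderiv ℝ α θ u v)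
        (((ContinuousLinearMap.apply ℝ ℝ v).comp
          (ContinuousLinearMap.apply ℝ ((Fin n → ℝ) →L[ℝ] ℝ) u)).comp
            (fderiv ℝ (fderiv ℝ α) θ)) θ :=
    HasFDerivAt.comp (g := (ContinuousLinearMap.apply ℝ ℝ v).comp
      (ContinuousLinearMap.apply ℝ ((Fin n → ℝ) →L[ℝ] ℝ) u)) θ
        (ContinuousLinearMap.hasFDerivAt _) (hdα' θ).hasFDerivAt
  have hsymα (θ u v w : Fin n → ℝ) :
      fderiv ℝ (fderiv ℝ α) θ u v w = fderiv ℝ (fderiv ℝ α) θ v u w :=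
    congrArg (fun l => l w) ((hα.contDiffAt.isSymmSndFDerivAt (by simp)) u v)
  have hsymh (θ u v : Fin n → ℝ) :
      fderiv ℝ (fderiv ℝ h) θ u v = fderiv ℝ (fderiv ℝ h) θ v u :=
    (hh.contDiffAt.isSymmSndFDerivAt (by simp)) u v
  have hex2 (θ u v : Fin n → ℝ) :
      fderiv ℝ (fderiv ℝ α) θ v u ω - fderiv ℝ (fderiv ℝ α) θ v ω u =
        fderiv ℝ (fderiv ℝ h) θ v u := by
    have h1 := (happ u ω θ).fun_sub (happ ω u θ)
    have h2 := ((ContinuousLinearMap.apply ℝ ℝ u).hasFDerivAt).comp θ (hdh' θ).hasFDerivAt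
    rw [funext fun θ => hex θ u] at h1
    have := h1.unique h2
    simpa using congrArg (fun l => l v) this
  let u : Fin n → ℝ := Pi.single i 1
  let v : Fin n → ℝ := Pi.single j 1
  let f : (Fin n → ℝ) → ℝ := fun θ => fderiv ℝ α θ u v - fderiv ℝ α θ v u
  have hfd (θ : Fin n → ℝ) := (happ u v θ).fun_sub (happ v u θ)
  have hfω (θ : Fin n → ℝ) : fderiv ℝ f θ ω = 0 := by
    rw [show fderiv ℝ f θ = _ from (hfd θ).fderiv]
    have h1 := hex2 θ u v
    have h2 := hex2 θ v u
    simp only [_root_.sub_apply, ContinuousLinearMap.comp_apply,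
      ContinuousLinearMap.apply_apply]
    rw [hsymα θ ω u v, hsymα θ ω v u]
    linear_combination h1 - h2 + hsymα θ u v ω + hsymh θ v u
  have hinv (θ : Fin n → ℝ) (t : ℝ) : f (θ + t • ω) = f θ := by
    have hline (s : ℝ) : HasDerivAt (fun s : ℝ => f (θ + s • ω)) 0 s := by
      have hl : HasDerivAt (fun s : ℝ => θ + s • ω) ω s := by
        simpa using ((hasDerivAt_id s).smul_const ω).const_add θ
      have hf : HasFDerivAt f (fderiv ℝ f (θ + s • ω)) (θ + s • ω) :=
        (hfd _).differentiableAt.hasFDerivAt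
      have := hf.comp_hasDerivAt s hl
      rwa [hfω] at this
    have := is_const_of_deriv_eq_zero (fun s => (hline s).differentiableAt)
      (fun s => (hline s).deriv) t 0
    simpa using this
  have hperf (θ : Fin n → ℝ) (k : Fin n → ℤ) : f (θ + fun i => (k i : ℝ)) = f θ := by
    have : fderiv ℝ α (θ + fun i => (k i : ℝ)) = fderiv ℝ α θ := by
      rw [← fderiv_comp_add_right]; simp_rw [hper]
    simp only [f, this]
  have hconst := eq_of_periodic_of_flow_invariant hω
    (f := f) (continuous_iff_continuousAt.2 fun θ => (hfd θ).continuousAt) hperf hinv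
  have hperu (l : Fin n) (x : Fin n → ℝ) : α (x + Pi.single l 1) = α x := by
    convert hper x (Pi.single l 1) using 3 with m
    ext m
    by_cases hm : m = l
    · subst hm; simp
    · simp [hm]
  have hap (w x : Fin n → ℝ) : HasFDerivAt (fun θ => α θ w)
      ((ContinuousLinearMap.apply ℝ ℝ w).comp (fderiv ℝ α x)) x :=
    ((ContinuousLinearMap.apply ℝ ℝ w).hasFDerivAt).comp x (hdα x).hasFDerivAt
  have hzero := const_eq_zero_of_fderiv_sub_fderiv (p := fun θ => α θ v) (q := fun θ => α θ u)
    (fun x => (hap v x).differentiableAt) (fun x => (hap u x).differentiableAt) (u := u) (v := v)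
    (fun x => by simp only [u, hperu]) (fun x => by simp only [v, hperu]) (C := f θ)
    (fun x => by
      rw [(hap v x).fderiv, (hap u x).fderiv, ← hconst x θ]
      rfl)
  exact sub_eq_zero.1 hzero

lemma pjac_mulVec {a b : ℕ} (f : (Fin a → ℝ) → (Fin b → ℝ)) (z w : Fin a → ℝ) :
    (pjac f z).mulVec w = fderiv ℝ f z w := by
  have : pjac f z = LinearMap.toMatrix' (fderiv ℝ f z : (Fin a → ℝ) →ₗ[ℝ] (Fin b → ℝ)) := by
    ext i j
    simp [pjac, LinearMap.toMatrix'_apply]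
  rw [this, LinearMap.toMatrix'_mulVec]
  rfl

lemma pgrad_dotProduct {d : ℕ} (H : (Fin d → ℝ) → ℝ) (z w : Fin d → ℝ) :
    w ⬝ᵥ pgrad H z = fderiv ℝ H z w := by
  conv_rhs => rw [pi_eq_sum_univ' w, map_sum]
  simp [dotProduct, pgrad]

/-- If `K` is a `C^∞`, `ℤⁿ`-periodic solution of the invariant-torus
equation `∂_ω K = B(K)∇H(K)` with `(γ,σ)`-Diophantine `ω`, for a `C^∞` invertible
structure matrix `B` whose inverse is exact (`B⁻¹ = Dcᵀ − Dc`), then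
`DK(θ)ᵀ B(K(θ))⁻¹ DK(θ) = 0` for all `θ`, i.e. the invariant torus is Lagrangian. -/
theorem stmt_6 {n : ℕ} (U : Set (Fin (2 * n) → ℝ)) (hU : IsOpen U)
    (B : (Fin (2 * n) → ℝ) → Matrix (Fin (2 * n)) (Fin (2 * n)) ℝ)
    (hB : ∀ i j, ContDiffOn ℝ (⊤ : ℕ∞) (fun z => B z i j) U)
    (hskew : ∀ z ∈ U, ∀ i j, B z i j = - B z j i)
    (hjacobi : ∀ z ∈ U, ∀ i j k,
      ∑ l, (fderiv ℝ (fun w => B w i j) z (Pi.single l 1) * B z l k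
          + fderiv ℝ (fun w => B w j k) z (Pi.single l 1) * B z l i
          + fderiv ℝ (fun w => B w k i) z (Pi.single l 1) * B z l j) = 0)
    (hBunit : ∀ z ∈ U, IsUnit (B z))
    (H : (Fin (2 * n) → ℝ) → ℝ) (hH : ContDiffOn ℝ (⊤ : ℕ∞) H U)
    (c : (Fin (2 * n) → ℝ) → (Fin (2 * n) → ℝ)) (hc : ContDiffOn ℝ (⊤ : ℕ∞) c U)
    (hexact : ∀ z ∈ U, (B z)⁻¹ = (pjac c z)ᵀ - pjac c z)
    (γ σ : ℝ) (hγ : 0 < γ) (hσ : 0 < σ)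
    (ω : Fin n → ℝ) (hω : IsDiophantine γ σ ω)
    (K : (Fin n → ℝ) → (Fin (2 * n) → ℝ)) (hK : ContDiff ℝ (⊤ : ℕ∞) K)
    (hKU : ∀ θ, K θ ∈ U)
    (hKper : ∀ (θ : Fin n → ℝ) (k : Fin n → ℤ), K (θ + fun i => (k i : ℝ)) = K θ)
    (hsol : ∀ θ, fderiv ℝ K θ ω = (B (K θ)).mulVec (pgrad H (K θ))) :
    ∀ θ, (pjac K θ)ᵀ * (B (K θ))⁻¹ * pjac K θ = 0 := by
  intro θ
  have hres (k : Fin n → ℤ) (hk : k ≠ 0) : ∑ i, (k i : ℝ) * ω i ≠ 0 := by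
    obtain ⟨i, hi⟩ := Function.ne_iff.1 hk
    have hpos : 0 < ∑ i, |(k i : ℝ)| :=
      Finset.sum_pos' (fun i _ => abs_nonneg _)
        ⟨i, Finset.mem_univ i, abs_pos.2 (Int.cast_ne_zero.2 hi)⟩
    exact abs_pos.1 ((mul_pos hγ (Real.rpow_pos_of_pos hpos _)).trans_le (hω k hk))
  have htwo : (2 : WithTop ℕ∞) ≤ ((⊤ : ℕ∞) : WithTop ℕ∞) :=
    WithTop.coe_le_coe.2 (le_top : (2 : ℕ∞) ≤ ⊤)
  have hcK : ContDiff ℝ (⊤ : ℕ∞) (fun θ => c (K θ)) := hc.comp_contDiff hK hKU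
  have hHK : ContDiff ℝ (⊤ : ℕ∞) (fun θ => H (K θ)) := hH.comp_contDiff hK hKU
  have hK' : ContDiff ℝ (⊤ : ℕ∞) (fderiv ℝ K) := hK.fderiv_right (by simp)
  let β : (Fin (2 * n) → ℝ) →L[ℝ] (Fin (2 * n) → ℝ) →L[ℝ] ℝ :=
    ∑ l, (ContinuousLinearMap.proj (R := ℝ) (φ := fun _ => ℝ) l).smulRight
      (ContinuousLinearMap.proj (R := ℝ) (φ := fun _ => ℝ) l)
  have hβ (x y : Fin (2 * n) → ℝ) : β x y = x ⬝ᵥ y := by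
    simp [β, dotProduct]
  let α : (Fin n → ℝ) → (Fin n → ℝ) →L[ℝ] ℝ := fun θ => (β (c (K θ))).comp (fderiv ℝ K θ)
  have hα : ContDiff ℝ (⊤ : ℕ∞) α := (β.contDiff.comp hcK).clm_comp hK'
  have hdc (θ u : Fin n → ℝ) :
      fderiv ℝ (fun θ => c (K θ)) θ u = fderiv ℝ c (K θ) (fderiv ℝ K θ u) := by
    have h1 : DifferentiableAt ℝ c (K θ) :=
      (hc.contDiffAt (hU.mem_nhds (hKU θ))).differentiableAt (by simp)
    exact congrArg (fun l => l u) (fderiv_fun_comp θ h1 (hK.differentiable (by simp) θ))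
  have hdH (θ u : Fin n → ℝ) :
      fderiv ℝ (fun θ => H (K θ)) θ u = fderiv ℝ H (K θ) (fderiv ℝ K θ u) := by
    have h1 : DifferentiableAt ℝ H (K θ) :=
      (hH.contDiffAt (hU.mem_nhds (hKU θ))).differentiableAt (by simp)
    exact congrArg (fun l => l u) (fderiv_fun_comp θ h1 (hK.differentiable (by simp) θ))
  have hdα (θ u v : Fin n → ℝ) : fderiv ℝ α θ u v =
      β (c (K θ)) (fderiv ℝ (fderiv ℝ K) θ u v) +
        β (fderiv ℝ c (K θ) (fderiv ℝ K θ u)) (fderiv ℝ K θ v) := by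
    have h1 := (β.hasFDerivAt.comp θ (hcK.differentiable (by simp) θ).hasFDerivAt).clm_comp
      (hK'.differentiable (by simp) θ).hasFDerivAt
    rw [show fderiv ℝ α θ = _ from h1.fderiv, ← hdc]
    rfl
  have hform (θ u v : Fin n → ℝ) : fderiv ℝ α θ u v - fderiv ℝ α θ v u =
      fderiv ℝ K θ u ⬝ᵥ (B (K θ))⁻¹.mulVec (fderiv ℝ K θ v) := by
    have hsym : fderiv ℝ (fderiv ℝ K) θ u v = fderiv ℝ (fderiv ℝ K) θ v u :=
      (hK.contDiffAt.isSymmSndFDerivAt (by simpa using htwo)) u v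
    rw [hdα, hdα, hsym, hexact _ (hKU θ), sub_mulVec, dotProduct_sub, mulVec_transpose,
      dotProduct_comm _ (_ ᵥ* _), ← dotProduct_mulVec, pjac_mulVec, pjac_mulVec, hβ, hβ, hβ,
      dotProduct_comm (fderiv ℝ K θ v), dotProduct_comm (fderiv ℝ c (K θ) (fderiv ℝ K θ v))]
    ring
  have hclosed := closed_of_contraction_exact hres (α := α) (hα.of_le htwo)
    (h := fun θ => H (K θ)) (hHK.of_le htwo)
    (fun θ k => by
      have : fderiv ℝ K (θ + fun i => (k i : ℝ)) = fderiv ℝ K θ := by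
        rw [← fderiv_comp_add_right]; simp_rw [hKper]
      simp only [α, this, hKper])
    (fun θ u => by
      rw [hform, hdH, hsol, mulVec_mulVec,
        nonsing_inv_mul _ ((isUnit_iff_isUnit_det _).1 (hBunit _ (hKU θ))), one_mulVec,
        pgrad_dotProduct])
  ext i j
  have hcol (j : Fin n) : (pjac K θ).col j = fderiv ℝ K θ (Pi.single j 1) := by
    rw [← pjac_mulVec, mulVec_single_one]
  have := sub_eq_zero.2 (hclosed θ i j)
  rw [hform, ← hcol, ← hcol] at this
  rw [Matrix.mul_assoc]
  exact this
end

section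
/- Let E be a real Banach space and F : E → E a continuous map. Let c > 0, γ > 0, σ ≥ 1, 0 < δ₀ ≤ 1, and set δ_m = δ₀ 2^{-m} for m ≥ 0. Let (K_m)_{m≥0} and (ΔK_m)_{m≥0} be sequences in E with K_{m+1} = K_m + ΔK_m, and let (ε_m)_{m≥0} be nonnegative real numbers such that for all m ≥ 0: ‖F(K_m)‖ ≤ ε_m; ‖ΔK_m‖ ≤ c γ^{-2} δ_m^{-2σ} ε_m; and ε_m ≤ c γ^{-4} δ_{m-1}^{-4σ} ε_{m-1}² for m ≥ 1. Assume κ := 2^{4σ} c γ^{-4} δ₀^{-4σ} ε₀ ≤ 1/2. Then (K_m) converges in E to some K_∞ with F(K_∞) = 0, and ‖K_∞ − K₀‖ ≤ c γ^{-2} δ₀^{-2σ} ε₀ (1 + κ · 2^{4σ}/(2^{2σ} − 1)). -/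
theorem quadratic_recursion_le {A q κ : ℝ} {ε : ℕ → ℝ} (hA : 0 ≤ A) (hq : 0 < q)
    (hε : ∀ m, 0 ≤ ε m) (hrec : ∀ m, ε (m + 1) ≤ A * (q ^ m) ^ 2 * ε m ^ 2)
    (hκ : κ = q ^ 2 * A * ε 0) (hκ_le : κ ≤ 1) (m : ℕ) :
    ε (m + 1) ≤ κ * ε 0 / (q ^ (m + 1)) ^ 2 := by
  have hκ0 : 0 ≤ κ := hκ ▸ mul_nonneg (by positivity) (hε 0)
  have h0 := hε 0
  induction m with
  | zero =>
    refine (hrec 0).trans (le_of_eq ?_)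
    rw [hκ]
    field_simp
    ring
  | succ m ih =>
    calc ε (m + 1 + 1) ≤ A * (q ^ (m + 1)) ^ 2 * ε (m + 1) ^ 2 := hrec _
      _ ≤ A * (q ^ (m + 1)) ^ 2 * (κ * ε 0 / (q ^ (m + 1)) ^ 2) ^ 2 := by
        have := hε (m + 1)
        gcongr
      _ = κ ^ 2 * (κ * ε 0 / (q ^ (m + 1 + 1)) ^ 2) := by
        nth_rewrite 3 [hκ]
        field_simp
        ring
      _ ≤ 1 * (κ * ε 0 / (q ^ (m + 1 + 1)) ^ 2) := by
        gcongr
        exact pow_le_one₀ hκ0 hκ_le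
      _ = _ := one_mul _

theorem tendsto_zero_of_quadratic_recursion {E : Type*} [NormedAddCommGroup E] [CompleteSpace E]
    {F : E → E} (hF : Continuous F) {A B q κ : ℝ} {K : ℕ → E} {ε : ℕ → ℝ}
    (hA : 0 ≤ A) (hB : 0 ≤ B) (hq : 1 < q) (hε : ∀ m, 0 ≤ ε m)
    (hFK : ∀ m, ‖F (K m)‖ ≤ ε m) (hK : ∀ m, ‖K (m + 1) - K m‖ ≤ B * q ^ m * ε m)
    (hrec : ∀ m, ε (m + 1) ≤ A * (q ^ m) ^ 2 * ε m ^ 2)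
    (hκ : κ = q ^ 2 * A * ε 0) (hκ_le : κ ≤ 1) :
    ∃ L : E, Filter.Tendsto K Filter.atTop (nhds L) ∧ F L = 0 ∧
      ‖L - K 0‖ ≤ B * ε 0 * (1 + κ / (q - 1)) := by
  have hq0 : 0 < q := by linarith
  have hr : q⁻¹ < 1 := inv_lt_one_of_one_lt₀ hq
  have hε_le := quadratic_recursion_le hA hq0 hε hrec hκ hκ_le
  have hdist : ∀ n, dist (K (n + 1)) (K (n + 1 + 1)) ≤ B * ε 0 * κ / q * q⁻¹ ^ n := by
    intro n
    rw [dist_comm, dist_eq_norm]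
    calc ‖K (n + 1 + 1) - K (n + 1)‖ ≤ B * q ^ (n + 1) * ε (n + 1) := hK _
      _ ≤ B * q ^ (n + 1) * (κ * ε 0 / (q ^ (n + 1)) ^ 2) := by
        gcongr
        exact hε_le n
      _ = _ := by
        rw [inv_pow]
        field_simp
        ring
  obtain ⟨L, hL⟩ := cauchySeq_tendsto_of_complete
    (cauchySeq_of_le_geometric q⁻¹ _ hr hdist)
  have hε_lim : Filter.Tendsto (fun n => ε (n + 1)) Filter.atTop (nhds 0) := by
    have hgeom : Filter.Tendsto (fun n : ℕ => κ * ε 0 * (q⁻¹ ^ (n + 1)) ^ 2)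
        Filter.atTop (nhds 0) := by
      simpa using ((((tendsto_pow_atTop_nhds_zero_of_lt_one (inv_nonneg.2 hq0.le) hr).comp
        (Filter.tendsto_add_atTop_nat 1)).pow 2).const_mul (κ * ε 0))
    refine squeeze_zero (fun n => hε _) (fun n => (hε_le n).trans (le_of_eq ?_)) hgeom
    rw [inv_pow, inv_pow, div_eq_mul_inv]
  refine ⟨L, (Filter.tendsto_add_atTop_iff_nat 1).1 hL, ?_, ?_⟩
  · exact tendsto_nhds_unique ((hF.tendsto L).comp hL)
      (squeeze_zero_norm (fun n => hFK (n + 1)) hε_lim)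
  · have h1 : ‖L - K 1‖ ≤ B * ε 0 * κ / q / (1 - q⁻¹) := by
      rw [← dist_eq_norm, dist_comm]
      exact dist_le_of_le_geometric_of_tendsto₀ q⁻¹ _ hr hdist hL
    have h2 : ‖K 1 - K 0‖ ≤ B * ε 0 := by simpa using hK 0
    have h3 : B * ε 0 * κ / q / (1 - q⁻¹) = B * ε 0 * (κ / (q - 1)) := by
      have : q - 1 ≠ 0 := by linarith
      have : 1 - q⁻¹ ≠ 0 := by linarith
      field_simp
    calc ‖L - K 0‖ ≤ ‖L - K 1‖ + ‖K 1 - K 0‖ := norm_sub_le_norm_sub_add_norm_sub _ _ _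
      _ ≤ B * ε 0 * (κ / (q - 1)) + B * ε 0 := add_le_add (h3 ▸ h1) h2
      _ = _ := by ring

theorem Real.div_two_pow_rpow_neg {δ : ℝ} (hδ : 0 ≤ δ) (s : ℝ) (m : ℕ) :
    (δ / 2 ^ m) ^ (-s) = δ ^ (-s) * ((2 : ℝ) ^ s) ^ m := by
  rw [Real.div_rpow hδ (by positivity), Real.rpow_neg (pow_nonneg zero_le_two m) s, div_inv_eq_mul,
    ← Real.rpow_natCast, ← Real.rpow_natCast, ← Real.rpow_mul (by norm_num),
    ← Real.rpow_mul (by norm_num), mul_comm s]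

/-- Abstract convergence of the quasi-Newton iteration in a Banach
space `E`: if `‖F(K_m)‖ ≤ ε_m`, `‖ΔK_m‖ ≤ c γ⁻² δ_m^{-2σ} ε_m`, the errors satisfy the
quadratic recursion `ε_m ≤ c γ⁻⁴ δ_{m-1}^{-4σ} ε_{m-1}²` and
`κ = 2^{4σ} c γ⁻⁴ δ₀^{-4σ} ε₀ ≤ 1/2`, then `K_m` converges to a zero `K_∞` of `F` with
`‖K_∞ − K₀‖ ≤ c γ⁻² δ₀^{-2σ} ε₀ (1 + κ 2^{4σ}/(2^{2σ} − 1))`. -/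
theorem stmt_12 {E : Type*} [NormedAddCommGroup E] [NormedSpace ℝ E] [CompleteSpace E]
    (F : E → E) (hF : Continuous F)
    (c γ σ δ₀ : ℝ) (hc : 0 < c) (hγ : 0 < γ) (hσ : 1 ≤ σ)
    (hδ₀ : 0 < δ₀) (hδ₀' : δ₀ ≤ 1)
    (K ΔK : ℕ → E) (ε : ℕ → ℝ)
    (hKrec : ∀ m, K (m + 1) = K m + ΔK m)
    (hεnn : ∀ m, 0 ≤ ε m)
    (hFbound : ∀ m, ‖F (K m)‖ ≤ ε m)
    (hΔbound : ∀ m, ‖ΔK m‖ ≤ c * γ ^ (-(2 : ℝ)) * (δ₀ / 2 ^ m) ^ (-(2 * σ)) * ε m)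
    (hεrec : ∀ m, ε (m + 1) ≤ c * γ ^ (-(4 : ℝ)) * (δ₀ / 2 ^ m) ^ (-(4 * σ)) * ε m ^ 2)
    (hκ : (2 : ℝ) ^ (4 * σ) * c * γ ^ (-(4 : ℝ)) * δ₀ ^ (-(4 * σ)) * ε 0 ≤ 1 / 2) :
    ∃ Klim : E, Filter.Tendsto K Filter.atTop (nhds Klim) ∧ F Klim = 0 ∧
      ‖Klim - K 0‖ ≤ c * γ ^ (-(2 : ℝ)) * δ₀ ^ (-(2 * σ)) * ε 0 *
        (1 + ((2 : ℝ) ^ (4 * σ) * c * γ ^ (-(4 : ℝ)) * δ₀ ^ (-(4 * σ)) * ε 0) *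
          (2 : ℝ) ^ (4 * σ) / ((2 : ℝ) ^ (2 * σ) - 1)) := by
  set q : ℝ := (2 : ℝ) ^ (2 * σ) with hq_def
  have hq : 1 < q := Real.one_lt_rpow (by norm_num) (by linarith)
  have hq2 : (2 : ℝ) ^ (4 * σ) = q ^ 2 := by
    rw [hq_def, ← Real.rpow_natCast, ← Real.rpow_mul (by norm_num)]
    congr 1
    push_cast
    ring
  rw [hq2] at hκ ⊢
  set κ : ℝ := q ^ 2 * c * γ ^ (-(4 : ℝ)) * δ₀ ^ (-(4 * σ)) * ε 0 with hκ_def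
  have hε0 := hεnn 0
  have hκ0 : 0 ≤ κ := by positivity
  have hq1 : 0 < q - 1 := by linarith
  obtain ⟨L, hL, hFL, hbound⟩ := tendsto_zero_of_quadratic_recursion (q := q) (κ := κ) (K := K)
    (A := c * γ ^ (-(4 : ℝ)) * δ₀ ^ (-(4 * σ))) (B := c * γ ^ (-(2 : ℝ)) * δ₀ ^ (-(2 * σ)))
    hF (by positivity) (by positivity) hq hεnn hFbound
    (fun m => by
      have := hΔbound m
      rw [Real.div_two_pow_rpow_neg hδ₀.le, ← hq_def] at this
      rw [hKrec, add_sub_cancel_left, mul_assoc (c * γ ^ (-(2 : ℝ)))]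
      exact this)
    (fun m => by
      have := hεrec m
      rw [Real.div_two_pow_rpow_neg hδ₀.le, hq2, pow_right_comm] at this
      rw [mul_assoc (c * γ ^ (-(4 : ℝ)))]
      exact this)
    (by rw [hκ_def]; ring) (by linarith)
  refine ⟨L, hL, hFL, hbound.trans ?_⟩
  gcongr
  exact le_mul_of_one_le_right hκ0 (one_le_pow₀ hq.le)
end

section
/- Let σ ≥ 1, c > 0, γ > 0, δ₀ > 0, and set δ_m = δ₀ 2^{-m} for m ≥ 0. Let (ε_m)_{m≥0} be nonnegative real numbers satisfying ε_m ≤ c γ^{-4} δ_{m-1}^{-4σ} ε_{m-1}² for all m ≥ 1, and set κ = 2^{4σ} c γ^{-4} δ₀^{-4σ} ε₀. Then for every j ≥ 1, ε_j ≤ κ^{2^j − 1} · 2^{−4σ j} · ε₀. -/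
/-- A quadratic recursion whose constants grow geometrically, `u (m + 1) ≤ A a ^ m (u m) ^ 2`,
forces superexponential decay once `a * A * u 0 < 1`. -/
theorem le_pow_two_pow_of_quadratic_recursion {a A : ℝ} (ha : 0 < a) (hA : 0 ≤ A) {u : ℕ → ℝ}
    (hu : ∀ m, 0 ≤ u m) (hrec : ∀ m, u (m + 1) ≤ A * a ^ m * u m ^ 2) (j : ℕ) :
    u j ≤ (a * A * u 0) ^ (2 ^ j - 1) * (a ^ j)⁻¹ * u 0 := by
  induction j with
  | zero => simp
  | succ m ih =>
    obtain ⟨n, hn⟩ : ∃ n, 2 ^ m = n + 1 := Nat.exists_eq_add_one.2 (by positivity)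
    have hm : 2 ^ m - 1 = n := by omega
    have hs : 2 ^ (m + 1) - 1 = 2 * n + 1 := by rw [pow_succ]; omega
    rw [hm] at ih
    rw [hs]
    calc u (m + 1) ≤ A * a ^ m * u m ^ 2 := hrec m
      _ ≤ A * a ^ m * ((a * A * u 0) ^ n * (a ^ m)⁻¹ * u 0) ^ 2 := by
        have := hu m
        gcongr
      _ = (a * A * u 0) ^ (2 * n + 1) * (a ^ (m + 1))⁻¹ * u 0 := by
        generalize hκ : (a * A * u 0) ^ n = p
        rw [pow_succ (a * A * u 0), mul_comm 2 n, pow_mul, hκ]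
        field_simp
        ring

/-- Superexponential decay of the error sizes along the quasi-Newton
iteration: if `ε_m ≤ c γ⁻⁴ δ_{m-1}^{-4σ} ε_{m-1}²` with `δ_m = δ₀ 2^{-m}` and
`κ = 2^{4σ} c γ⁻⁴ δ₀^{-4σ} ε₀`, then `ε_j ≤ κ^{2^j − 1} 2^{−4σj} ε₀` for every `j ≥ 1`. -/
theorem stmt_14 (σ c γ δ₀ : ℝ) (hσ : 1 ≤ σ) (hc : 0 < c) (hγ : 0 < γ) (hδ₀ : 0 < δ₀)
    (ε : ℕ → ℝ) (hεnn : ∀ m, 0 ≤ ε m)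
    (hrec : ∀ m : ℕ, ε (m + 1) ≤ c * γ ^ (-(4 : ℝ)) * (δ₀ / 2 ^ m) ^ (-(4 * σ)) * ε m ^ 2) :
    ∀ j : ℕ, 1 ≤ j →
      ε j ≤ ((2 : ℝ) ^ (4 * σ) * c * γ ^ (-(4 : ℝ)) * δ₀ ^ (-(4 * σ)) * ε 0) ^ (2 ^ j - 1) *
        (2 : ℝ) ^ (-(4 * σ * (j : ℝ))) * ε 0 := by
  intro j _
  have hrpow (m : ℕ) : (2 : ℝ) ^ (4 * σ * (m : ℝ)) = ((2 : ℝ) ^ (4 * σ)) ^ m :=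
    Real.rpow_mul_natCast zero_le_two _ _
  have hδ (m : ℕ) : (δ₀ / 2 ^ m) ^ (-(4 * σ)) = δ₀ ^ (-(4 * σ)) * ((2 : ℝ) ^ (4 * σ)) ^ m := by
    rw [Real.div_rpow hδ₀.le (by positivity), Real.rpow_neg (by positivity : (0 : ℝ) ≤ 2 ^ m),
      div_inv_eq_mul, ← Real.rpow_natCast_mul zero_le_two, mul_comm (m : ℝ), hrpow]
  have h := le_pow_two_pow_of_quadratic_recursion (a := (2 : ℝ) ^ (4 * σ))
    (A := c * γ ^ (-(4 : ℝ)) * δ₀ ^ (-(4 * σ))) (by positivity) (by positivity) hεnn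
    (fun m => by simpa only [hδ, mul_assoc] using hrec m) j
  rw [Real.rpow_neg zero_le_two, hrpow]
  simpa only [mul_assoc] using h
end

section
/- Let U ⊆ ℝ^{2n} be open, let B : U → M_{2n}(ℝ) be a real analytic structure matrix with B(z) invertible for all z ∈ U, let H : U → ℝ and c : U → ℝ^{2n} be real analytic with B(z)^{-1} = Dc(z)^T − Dc(z) for all z ∈ U. Let γ > 0, σ > 0, let ω ∈ ℝ^n be (γ,σ)-Diophantine, and let K : ℝ^n → U be real analytic and ℤ^n-periodic; set e(θ) = B(K(θ))∇H(K(θ)) − ∂_ω K(θ). Then there exist a real analytic ℤ^n-periodic function b̃ : ℝ^n → ℝ, a real analytic ℤ^n-periodic map g : ℝ^n → ℝ^n with ∫_{[0,1]^n} g(θ)dθ = 0, and a constant vector a₀ ∈ ℝ^n such that DK(θ)^T c(K(θ)) = ∇b̃(θ) + a₀ + g(θ) and ∂_ω g(θ) = DK(θ)^T B(K(θ))^{-1} e(θ) for all θ ∈ ℝ^n. -/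
open MeasureTheory Matrix

section

open scoped Nat NNReal ENNReal Topology

theorem FormalMultilinearSeries.exists_norm_changeOrigin_le {E F : Type*}
    [NormedAddCommGroup E] [NormedSpace ℝ E] [NormedAddCommGroup F] [NormedSpace ℝ F]
    (p : FormalMultilinearSeries ℝ E F) {r : ℝ≥0} (hr0 : 0 < r) (hr : (r + r : ℝ≥0∞) < p.radius) :
    ∃ C : ℝ≥0, ∀ x : E, ‖x‖₊ ≤ r → ∀ m, ‖p.changeOrigin x m‖₊ ≤ C * (r⁻¹) ^ m := by
  have hs := p.changeOriginSeries_summable_aux₁ hr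
  refine ⟨∑' s : Σ k l : ℕ, { s : Finset (Fin (k + l)) // s.card = l },
      ‖p (s.1 + s.2.1)‖₊ * r ^ s.2.1 * r ^ s.1, fun x hx m => ?_⟩
  have hxr : (‖x‖₊ : ℝ≥0∞) < p.radius := by
    refine lt_of_le_of_lt ?_ hr
    exact le_add_right (by exact_mod_cast hx)
  have h1 := p.nnnorm_changeOrigin_le m hxr
  have h2 := NNReal.summable_sigma.1 hs
  have h3 : ‖p.changeOrigin x m‖₊ * r ^ m ≤
      ∑' s : Σ l : ℕ, { s : Finset (Fin (m + l)) // s.card = l },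
        ‖p (m + s.1)‖₊ * r ^ s.1 * r ^ m := by
    rw [NNReal.tsum_mul_right]
    gcongr
    refine h1.trans (Summable.tsum_le_tsum (fun s => ?_) (p.changeOriginSeries_summable_aux₂ hxr m)
      (p.changeOriginSeries_summable_aux₂ (lt_of_le_of_lt (le_add_right le_rfl) hr) m))
    gcongr
  rw [inv_pow, ← div_eq_mul_inv, le_div_iff₀ (pow_pos hr0 m)]
  refine h3.trans ?_
  rw [hs.tsum_sigma' h2.1]
  exact h2.2.le_tsum m (fun _ _ => zero_le)

theorem AnalyticAt.eventually_norm_iteratedFDeriv_le {E F : Type*}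
    [NormedAddCommGroup E] [NormedSpace ℝ E] [NormedAddCommGroup F] [NormedSpace ℝ F]
    [CompleteSpace F] {f : E → F} {x : E} (hf : AnalyticAt ℝ f x) :
    ∃ C M : ℝ, ∀ᶠ y in 𝓝 x, ∀ (m : ℕ) (v : E),
      ‖iteratedFDeriv ℝ m f y (fun _ => v)‖ ≤ C * m ! * (M * ‖v‖) ^ m := by
  obtain ⟨p, R, hp⟩ := hf
  obtain ⟨r, hr0, hr⟩ := ENNReal.lt_iff_exists_nnreal_btwn.1 hp.r_pos
  have hr0' : 0 < r := by exact_mod_cast hr0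
  have hh : ((r / 2 : ℝ≥0) + (r / 2 : ℝ≥0) : ℝ≥0∞) = r := by
    rw [← ENNReal.coe_add, add_halves]
  obtain ⟨C, hC⟩ := p.exists_norm_changeOrigin_le (r := r / 2) (by positivity)
    (by rw [hh]; exact hr.trans_le hp.r_le)
  refine ⟨C, ((r / 2)⁻¹ : ℝ≥0), ?_⟩
  filter_upwards [Metric.closedBall_mem_nhds x (ε := ((r / 2 : ℝ≥0) : ℝ)) (by positivity)]
    with y hy m v
  have hy' : ‖y - x‖₊ ≤ r / 2 := by
    rw [mem_closedBall_iff_norm] at hy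
    exact_mod_cast hy
  have hyR : (‖y - x‖₊ : ℝ≥0∞) < R := by
    refine lt_of_le_of_lt ?_ hr
    exact_mod_cast hy'.trans (by rw [← NNReal.coe_le_coe]; push_cast; linarith [r.2])
  have hq := hp.changeOrigin hyR
  rw [add_sub_cancel] at hq
  rw [← hq.factorial_smul v m, ← Nat.cast_smul_eq_nsmul ℝ, norm_smul]
  have h1 : ‖p.changeOrigin (y - x) m‖ ≤ C * (((r / 2)⁻¹ : ℝ≥0) : ℝ) ^ m := by
    exact_mod_cast hC _ hy' m
  have h2 := (p.changeOrigin (y - x) m).le_opNorm (fun _ => v)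
  simp only [Finset.prod_const, Finset.card_univ, Fintype.card_fin] at h2
  rw [Real.norm_natCast, mul_pow]
  calc (m ! : ℝ) * ‖p.changeOrigin (y - x) m fun _ => v‖
      ≤ m ! * (C * (((r / 2)⁻¹ : ℝ≥0) : ℝ) ^ m * ‖v‖ ^ m) := by
        gcongr
        exact h2.trans (by gcongr)
    _ = _ := by ring

/-- Uniform derivative bounds for a periodic real analytic function. -/
theorem exists_norm_iteratedFDeriv_le_of_periodic {n : ℕ} {F : Type*}
    [NormedAddCommGroup F] [NormedSpace ℝ F] [CompleteSpace F] {f : (Fin n → ℝ) → F}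
    (hf : ∀ θ, AnalyticAt ℝ f θ)
    (hper : ∀ (θ : Fin n → ℝ) (k : Fin n → ℤ), f (θ + fun i => (k i : ℝ)) = f θ) :
    ∃ C M : ℝ, 0 < C ∧ 0 < M ∧ ∀ (θ : Fin n → ℝ) (m : ℕ) (v : Fin n → ℝ),
      ‖iteratedFDeriv ℝ m f θ (fun _ => v)‖ ≤ C * m ! * (M * ‖v‖) ^ m := by
  choose C M h using fun θ => (hf θ).eventually_norm_iteratedFDeriv_le
  obtain ⟨t, -, ht⟩ := (isCompact_Icc (a := (0 : Fin n → ℝ)) (b := 1)).elim_nhds_subcover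
    (fun θ => {y | ∀ (m : ℕ) (v : Fin n → ℝ),
      ‖iteratedFDeriv ℝ m f y (fun _ => v)‖ ≤ C θ * m ! * (M θ * ‖v‖) ^ m}) (fun θ _ => h θ)
  refine ⟨1 + ∑ s ∈ t, |C s|, 1 + ∑ s ∈ t, |M s|, by positivity, by positivity, fun θ m v => ?_⟩
  have hred : iteratedFDeriv ℝ m f θ = iteratedFDeriv ℝ m f (fun i => Int.fract (θ i)) := by
    have hff : f = fun z => f (z + fun i => ((⌊θ i⌋ : ℤ) : ℝ)) := by
      funext z; exact (hper z _).symm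
    conv_rhs => rw [hff]
    rw [iteratedFDeriv_comp_add_right]
    congr 1
    funext i
    simp
  rw [hred]
  have hmem : (fun i => Int.fract (θ i)) ∈ Set.Icc (0 : Fin n → ℝ) 1 :=
    ⟨fun i => Int.fract_nonneg _, fun i => (Int.fract_lt_one _).le⟩
  obtain ⟨s, hs, hs'⟩ := Set.mem_iUnion₂.1 (ht hmem)
  refine (hs' m v).trans ?_
  have hC : |C s| ≤ 1 + ∑ s ∈ t, |C s| := by
    linarith [Finset.single_le_sum (f := fun s => |C s|) (fun _ _ => abs_nonneg _) hs]
  have hM : |M s| ≤ 1 + ∑ s ∈ t, |M s| := by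
    linarith [Finset.single_le_sum (f := fun s => |M s|) (fun _ _ => abs_nonneg _) hs]
  calc C s * m ! * (M s * ‖v‖) ^ m ≤ |C s * m ! * (M s * ‖v‖) ^ m| := le_abs_self _
    _ = |C s| * m ! * (|M s| * ‖v‖) ^ m := by
      simp [abs_mul, abs_pow]
    _ ≤ _ := by gcongr

/-- The linear phase `θ ↦ 2πi k·θ`. -/
noncomputable def phase {n : ℕ} (k : Fin n → ℤ) : (Fin n → ℝ) →L[ℝ] ℂ :=
  ∑ j, (2 * Real.pi * Complex.I * k j) •
    (Complex.ofRealCLM.comp (ContinuousLinearMap.proj j : (Fin n → ℝ) →L[ℝ] ℝ))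

theorem phase_apply {n : ℕ} (k : Fin n → ℤ) (θ : Fin n → ℝ) :
    phase k θ = 2 * Real.pi * Complex.I * ((∑ j, (k j : ℝ) * θ j : ℝ) : ℂ) := by
  simp [phase, Finset.mul_sum, mul_assoc]

theorem phase_single {n : ℕ} (k : Fin n → ℤ) (j : Fin n) :
    phase k (Pi.single j 1) = 2 * Real.pi * Complex.I * k j := by
  rw [phase_apply]
  simp [Pi.single_apply]

theorem norm_exp_phase {n : ℕ} (k : Fin n → ℤ) (θ : Fin n → ℝ) :
    ‖Complex.exp (phase k θ)‖ = 1 := by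
  rw [phase_apply, Complex.norm_exp]
  simp

theorem exp_phase_add_int {n : ℕ} (k : Fin n → ℤ) (θ : Fin n → ℝ) (l : Fin n → ℤ) :
    Complex.exp (phase k (θ + fun i => (l i : ℝ))) = Complex.exp (phase k θ) := by
  rw [map_add, Complex.exp_add]
  have : phase k (fun i => (l i : ℝ)) = ((∑ j, k j * l j : ℤ) : ℂ) * (2 * Real.pi * Complex.I) := by
    rw [phase_apply]; push_cast; ring
  rw [this, Complex.exp_int_mul_two_pi_mul_I, mul_one]

theorem norm_phase_le {n : ℕ} (k : Fin n → ℤ) :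
    ‖phase k‖ ≤ 2 * Real.pi * ∑ i, |(k i : ℝ)| := by
  refine ContinuousLinearMap.opNorm_le_bound _ (by positivity) fun θ => ?_
  rw [phase_apply]
  simp only [norm_mul, Complex.norm_I, Complex.norm_real, Complex.norm_ofNat, mul_one,
    Real.norm_eq_abs, abs_of_pos Real.pi_pos]
  rw [mul_assoc (2 * Real.pi)]
  gcongr
  rw [Finset.sum_mul]
  refine (Finset.abs_sum_le_sum_abs _ _).trans (Finset.sum_le_sum fun i _ => ?_)
  rw [abs_mul]
  gcongr
  exact norm_le_pi_norm θ i

theorem mFourier_coe {n : ℕ} (k : Fin n → ℤ) (θ : Fin n → ℝ) :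
    UnitAddTorus.mFourier k (fun i => (θ i : UnitAddCircle)) = Complex.exp (phase k θ) := by
  simp only [UnitAddTorus.mFourier, ContinuousMap.coe_mk, fourier_coe_apply]
  rw [← Complex.exp_sum, phase_apply]
  congr 1
  push_cast
  rw [Finset.mul_sum]
  refine Finset.sum_congr rfl fun i _ => ?_
  simp; ring

/-- The `k`-th Fourier coefficient of a function on the unit cube. -/
noncomputable def cubeCoeff {n : ℕ} (f : (Fin n → ℝ) → ℂ) (k : Fin n → ℤ) : ℂ :=
  ∫ θ in Set.Icc (0 : Fin n → ℝ) 1, Complex.exp (phase (-k) θ) * f θ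

theorem exists_torus_lift {n : ℕ} {f : (Fin n → ℝ) → ℂ} (hf : Continuous f)
    (hper : ∀ (θ : Fin n → ℝ) (k : Fin n → ℤ), f (θ + fun i => (k i : ℝ)) = f θ) :
    ∃ F : C(UnitAddTorus (Fin n), ℂ), ∀ θ : Fin n → ℝ,
      F (fun i => (θ i : UnitAddCircle)) = f θ := by
  have hq : IsOpenQuotientMap
      (Pi.map fun _ : Fin n => ((↑) : ℝ → UnitAddCircle)) :=
    IsOpenQuotientMap.piMap fun _ => QuotientAddGroup.isOpenQuotientMap_mk
  have hfib : ∀ a b : Fin n → ℝ, Pi.map (fun _ : Fin n => ((↑) : ℝ → UnitAddCircle)) a =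
      Pi.map (fun _ : Fin n => ((↑) : ℝ → UnitAddCircle)) b → f a = f b := by
    intro a b hab
    have h1 : ∀ i, ∃ m : ℤ, (m : ℝ) = b i - a i := by
      intro i
      have := congrFun hab i
      simp only [Pi.map_apply] at this
      have := (QuotientAddGroup.eq_iff_sub_mem.1 this.symm)
      rw [AddSubgroup.mem_zmultiples_iff] at this
      obtain ⟨m, hm⟩ := this
      exact ⟨m, by simpa using hm⟩
    choose m hm using h1
    rw [← hper a m]
    congr 1
    funext i
    simp [hm]
  let q : C(Fin n → ℝ, UnitAddTorus (Fin n)) := ⟨_, hq.continuous⟩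
  have hq' : Topology.IsQuotientMap q := hq.isQuotientMap
  refine ⟨hq'.lift ⟨f, hf⟩ fun a b h => hfib a b h, fun θ => ?_⟩
  exact DFunLike.congr_fun (hq'.lift_comp ⟨f, hf⟩ fun a b h => hfib a b h) θ

theorem mFourierCoeff_eq_cubeCoeff {n : ℕ} {f : (Fin n → ℝ) → ℂ}
    {F : C(UnitAddTorus (Fin n), ℂ)}
    (hF : ∀ θ : Fin n → ℝ, F (fun i => (θ i : UnitAddCircle)) = f θ) (k : Fin n → ℤ) :
    UnitAddTorus.mFourierCoeff F k = cubeCoeff f k := by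
  rw [UnitAddTorus.mFourierCoeff_eq_integral F k 0, cubeCoeff]
  have h1 : {x : Fin n → ℝ | ∀ i, x i ∈ Set.Ioc ((0 : Fin n → ℝ) i) ((0 : Fin n → ℝ) i + 1)}
      = Set.pi Set.univ fun i => Set.Ioc ((0 : Fin n → ℝ) i) ((1 : Fin n → ℝ) i) := by
    ext x; simp [Set.mem_pi]
  rw [h1, volume_pi, setIntegral_congr_set Measure.univ_pi_Ioc_ae_eq_Icc]
  simp only [hF, mFourier_coe, smul_eq_mul]

theorem integral_fderiv_single_eq_zero {n : ℕ} {E : Type*} [NormedAddCommGroup E] [NormedSpace ℝ E]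
    [CompleteSpace E] {f : (Fin n → ℝ) → E} (hf : ContDiff ℝ 1 f)
    (hper : ∀ (θ : Fin n → ℝ) (k : Fin n → ℤ), f (θ + fun i => (k i : ℝ)) = f θ) (j : Fin n) :
    ∫ θ in Set.Icc (0 : Fin n → ℝ) 1, fderiv ℝ f θ (Pi.single j 1) = 0 := by
  obtain _ | n := n
  · exact j.elim0
  have hd := integral_divergence_of_hasFDerivAt_off_countable' (E := E) (0 : Fin (n + 1) → ℝ) 1
    (fun _ => zero_le_one) (fun i θ => if i = j then f θ else 0)
    (fun i θ => if i = j then fderiv ℝ f θ else 0) ∅ Set.countable_empty ?_ ?_ ?_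
  · have hs : ∀ θ : Fin (n + 1) → ℝ,
        (∑ i, (if i = j then fderiv ℝ f θ else 0 : (Fin (n + 1) → ℝ) →L[ℝ] E)
        (Pi.single i 1))
        = fderiv ℝ f θ (Pi.single j 1) := by
      intro θ
      rw [Finset.sum_eq_single j] <;> simp +contextual
    simp only [hs] at hd
    rw [hd]
    refine Finset.sum_eq_zero fun i _ => ?_
    by_cases hij : i = j
    · subst hij
      simp only [if_true]
      rw [sub_eq_zero]
      congr 1
      funext x
      rw [← hper (i.insertNth ((0 : Fin (n + 1) → ℝ) i) x) (Pi.single i 1)]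
      congr 1
      funext l
      refine Fin.succAboveCases i ?_ (fun l => ?_) l
      · simp
      · simp
    · simp [hij]
  · intro i
    by_cases hij : i = j
    · simpa [hij] using hf.continuous.continuousOn
    · simpa [hij] using continuousOn_const
  · intro x _ i
    by_cases hij : i = j
    · simpa [hij] using (hf.differentiable one_ne_zero x).hasFDerivAt
    · simpa [hij] using hasFDerivAt_const _ _
  · refine Continuous.integrableOn_Icc ?_
    refine continuous_finsetSum _ fun i _ => ?_
    by_cases hij : i = j
    · simpa [hij] using (hf.continuous_fderiv one_ne_zero).clm_apply continuous_const
    · simpa [hij] using continuous_const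

theorem cubeCoeff_fderiv {n : ℕ} {f : (Fin n → ℝ) → ℂ} (hf : ContDiff ℝ 1 f)
    (hper : ∀ (θ : Fin n → ℝ) (k : Fin n → ℤ), f (θ + fun i => (k i : ℝ)) = f θ) (j : Fin n)
    (k : Fin n → ℤ) :
    cubeCoeff (fun θ => fderiv ℝ f θ (Pi.single j 1)) k =
      2 * Real.pi * Complex.I * k j * cubeCoeff f k := by
  have hE : ContDiff ℝ 1 fun θ => Complex.exp (phase (-k) θ) := (phase (-k)).contDiff.cexp
  have h0 := integral_fderiv_single_eq_zero (f := fun θ => Complex.exp (phase (-k) θ) * f θ)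
    (hE.mul hf) (fun θ l => by rw [exp_phase_add_int, hper]) j
  have h1 : ∀ θ, fderiv ℝ (fun θ => Complex.exp (phase (-k) θ) * f θ) θ (Pi.single j 1) =
      Complex.exp (phase (-k) θ) * fderiv ℝ f θ (Pi.single j 1) -
        2 * Real.pi * Complex.I * k j * (Complex.exp (phase (-k) θ) * f θ) := by
    intro θ
    have := (((phase (-k)).hasFDerivAt (x := θ)).cexp).mul
      ((hf.differentiable one_ne_zero θ).hasFDerivAt)
    erw [this.fderiv]
    simp [phase_single]
    ring
  simp only [h1] at h0
  rw [integral_sub, sub_eq_zero, integral_const_mul] at h0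
  · exact h0
  · exact (hE.continuous.mul ((hf.continuous_fderiv one_ne_zero).clm_apply
      continuous_const)).integrableOn_Icc
  · exact (continuous_const.mul (hE.continuous.mul hf.continuous)).integrableOn_Icc

theorem norm_cubeCoeff_le {n : ℕ} {f : (Fin n → ℝ) → ℂ} {C : ℝ} (hC : ∀ θ, ‖f θ‖ ≤ C)
    (k : Fin n → ℤ) : ‖cubeCoeff f k‖ ≤ C := by
  refine (norm_setIntegral_le_of_norm_le_const (C := C) ?_ ?_).trans ?_
  · simp [Real.volume_Icc_pi]
  · intro θ _
    rw [norm_mul, norm_exp_phase, one_mul]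
    exact hC θ
  · simp [Measure.real, Real.volume_Icc_pi]

theorem summable_exp_neg_mul_abs_int {a : ℝ} (ha : 0 < a) :
    Summable fun m : ℤ => Real.exp (-a * |(m : ℝ)|) := by
  have h : Summable fun m : ℕ => Real.exp (-a * |((m : ℤ) : ℝ)|) := by
    have := Real.summable_exp_nat_mul_iff.2 (neg_lt_zero.2 ha)
    refine this.congr fun m => ?_
    simp [mul_comm]
  refine Summable.of_nat_of_neg h (h.congr fun m => by simp)

theorem summable_exp_neg_mul_sum_abs {a : ℝ} (ha : 0 < a) (n : ℕ) :
    Summable fun k : Fin n → ℤ => Real.exp (-a * ∑ i, |(k i : ℝ)|) := by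
  induction n with
  | zero => exact (hasSum_fintype _).summable
  | succ n ih =>
    rw [← (Fin.consEquiv fun _ : Fin (n + 1) => ℤ).summable_iff]
    have := (summable_exp_neg_mul_abs_int ha).mul_of_nonneg ih (fun _ => (Real.exp_pos _).le)
      (fun _ => (Real.exp_pos _).le)
    refine this.congr fun x => ?_
    rw [← Real.exp_add, Function.comp_apply, Fin.sum_univ_succ]
    simp [mul_add]

theorem analyticAt_tsum_mul_exp {ι E : Type*} [NormedAddCommGroup E] [NormedSpace ℝ E]
    {c : ι → ℂ} {L : ι → E →L[ℝ] ℂ} {r : ℝ≥0} (hr : 0 < r)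
    (hs : Summable fun k => ‖c k‖ * Real.exp (r * ‖L k‖)) :
    AnalyticAt ℝ (fun x => ∑' k, c k * Complex.exp (L k x)) 0 := by
  let t : ι → (m : ℕ) → ContinuousMultilinearMap ℝ (fun _ : Fin m => E) ℂ := fun k m =>
    (c k / m ! : ℂ) • (ContinuousMultilinearMap.mkPiAlgebraFin ℝ m ℂ).compContinuousLinearMap
      (fun _ => L k)
  have htn : ∀ k m, ‖t k m‖ * (r : ℝ) ^ m ≤ ‖c k‖ * ((r * ‖L k‖) ^ m / m !) := by
    intro k m
    have h1 : ‖t k m‖ ≤ ‖c k‖ / m ! * ‖L k‖ ^ m := by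
      simp only [t, norm_smul, norm_div, Complex.norm_natCast]
      gcongr
      refine (ContinuousMultilinearMap.norm_compContinuousLinearMap_le _ _).trans ?_
      simp
    calc ‖t k m‖ * (r : ℝ) ^ m ≤ ‖c k‖ / m ! * ‖L k‖ ^ m * (r : ℝ) ^ m := by gcongr
      _ = _ := by rw [mul_pow]; ring
  have htv : ∀ k m y, t k m (fun _ => y) = c k * ((L k y) ^ m / m !) := by
    intro k m y
    simp [t]
    ring
  have hexp : ∀ x : ℝ, HasSum (fun m : ℕ => x ^ m / m !) (Real.exp x) := by
    intro x
    rw [Real.exp_eq_exp_ℝ]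
    exact NormedSpace.expSeries_div_hasSum_exp x
  have hmaj : Summable fun q : ι × ℕ => ‖c q.1‖ * ((r * ‖L q.1‖) ^ q.2 / q.2 !) := by
    rw [summable_prod_of_nonneg (fun q => by positivity)]
    have h1 : ∀ k, HasSum (fun m : ℕ => ‖c k‖ * ((r * ‖L k‖) ^ m / m !))
        (‖c k‖ * Real.exp (r * ‖L k‖)) := fun k => (hexp (r * ‖L k‖)).mul_left ‖c k‖
    refine ⟨fun k => (h1 k).summable, ?_⟩
    simp only [fun k => (h1 k).tsum_eq]
    exact hs
  have htr : Summable fun q : ι × ℕ => ‖t q.1 q.2‖ * (r : ℝ) ^ q.2 :=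
    Summable.of_nonneg_of_le (fun q => by positivity) (fun q => htn q.1 q.2) hmaj
  have htr' : Summable fun q : ℕ × ι => ‖t q.2 q.1‖ * (r : ℝ) ^ q.1 := htr.prod_symm
  have htm : ∀ m, Summable fun k => ‖t k m‖ := fun m => by
    have := htr'.prod_factor m
    simp only at this
    exact (summable_mul_right_iff (pow_ne_zero m (NNReal.coe_ne_zero.2 hr.ne'))).1 this
  let p : FormalMultilinearSeries ℝ E ℂ := fun m => ∑' k, t k m
  refine HasFPowerSeriesAt.analyticAt (p := p) ⟨r, ?_, by exact_mod_cast hr, ?_⟩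
  · refine p.le_radius_of_bound (∑' q : ℕ × ι, ‖t q.2 q.1‖ * (r : ℝ) ^ q.1) fun m => ?_
    calc ‖p m‖ * (r : ℝ) ^ m ≤ (∑' k, ‖t k m‖) * (r : ℝ) ^ m := by
          gcongr
          exact norm_tsum_le_tsum_norm (htm m)
      _ = ∑' k, ‖t k m‖ * (r : ℝ) ^ m := tsum_mul_right.symm
      _ ≤ _ := by
          rw [htr'.tsum_prod]
          exact htr'.prod.le_tsum m (fun _ _ => tsum_nonneg fun _ => by positivity)
  · intro y hy
    have hyr : ‖y‖ ≤ r := by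
      rw [Metric.mem_eball, edist_zero_right] at hy
      exact_mod_cast hy.le
    have hsum : Summable fun q : ι × ℕ => t q.1 q.2 (fun _ => y) := by
      refine Summable.of_norm_bounded htr fun q => ?_
      refine ((t q.1 q.2).le_opNorm _).trans ?_
      simp only [Finset.prod_const, Finset.card_univ, Fintype.card_fin]
      gcongr
    have hsum' : Summable fun q : ℕ × ι => t q.2 q.1 (fun _ => y) := hsum.prod_symm
    have hval : (∑' k, c k * Complex.exp (L k (0 + y))) = ∑' q : ℕ × ι, t q.2 q.1 (fun _ => y) := by
      rw [← (Equiv.prodComm ι ℕ).tsum_eq, zero_add]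
      change _ = ∑' q : ι × ℕ, t q.1 q.2 (fun _ => y)
      rw [hsum.tsum_prod]
      refine tsum_congr fun k => ?_
      simp only [htv]
      rw [tsum_mul_left, Complex.exp_eq_exp_ℂ,
        (NormedSpace.expSeries_div_hasSum_exp (L k y)).tsum_eq]
    rw [hval]
    refine hsum'.hasSum.prod_fiberwise fun m => ?_
    have hp : HasSum (fun k => t k m) (p m) := (htm m).of_norm.hasSum
    exact ContinuousMultilinearMap.hasSum_eval hp (fun _ => y)

theorem fderiv_periodic {n : ℕ} {F : Type*} [NormedAddCommGroup F] [NormedSpace ℝ F]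
    {f : (Fin n → ℝ) → F}
    (hper : ∀ (θ : Fin n → ℝ) (k : Fin n → ℤ), f (θ + fun i => (k i : ℝ)) = f θ)
    (θ : Fin n → ℝ) (k : Fin n → ℤ) :
    fderiv ℝ f (θ + fun i => (k i : ℝ)) = fderiv ℝ f θ := by
  rw [← fderiv_comp_add_right]
  congr 1
  funext z
  exact hper z k

theorem iteratedFDeriv_periodic {n : ℕ} {F : Type*} [NormedAddCommGroup F] [NormedSpace ℝ F]
    {f : (Fin n → ℝ) → F}
    (hper : ∀ (θ : Fin n → ℝ) (k : Fin n → ℤ), f (θ + fun i => (k i : ℝ)) = f θ) (m : ℕ)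
    (θ : Fin n → ℝ) (k : Fin n → ℤ) :
    iteratedFDeriv ℝ m f (θ + fun i => (k i : ℝ)) = iteratedFDeriv ℝ m f θ := by
  rw [← iteratedFDeriv_comp_add_right]
  congr 1
  funext z
  exact hper z k

theorem cubeCoeff_iteratedFDeriv {n : ℕ} {f : (Fin n → ℝ) → ℂ} (hf : ContDiff ℝ (⊤ : ℕ∞) f)
    (hper : ∀ (θ : Fin n → ℝ) (k : Fin n → ℤ), f (θ + fun i => (k i : ℝ)) = f θ) (j : Fin n)
    (k : Fin n → ℤ) (m : ℕ) :
    cubeCoeff (fun θ => iteratedFDeriv ℝ m f θ (fun _ => Pi.single j 1)) k =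
      (2 * Real.pi * Complex.I * k j) ^ m * cubeCoeff f k := by
  induction m with
  | zero => simp
  | succ m ih =>
    have hm : ContDiff ℝ 1 (iteratedFDeriv ℝ m f) :=
      hf.iteratedFDeriv_right (by exact_mod_cast le_top)
    have hm' : ContDiff ℝ 1 fun θ => iteratedFDeriv ℝ m f θ (fun _ => Pi.single j 1) :=
      (ContinuousMultilinearMap.apply ℝ _ ℂ
        (fun _ : Fin m => (Pi.single j 1 : Fin n → ℝ))).contDiff.comp hm
    have := cubeCoeff_fderiv hm' (fun θ l => by rw [iteratedFDeriv_periodic hper]) j k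
    rw [ih] at this
    rw [pow_succ', mul_assoc, ← this]
    congr 1
    funext θ
    rw [iteratedFDeriv_succ_apply_left]
    have h2 := (hm.differentiable one_ne_zero θ).hasFDerivAt
    have h3 := ((ContinuousMultilinearMap.apply ℝ _ ℂ
        (fun _ : Fin m => (Pi.single j 1 : Fin n → ℝ))).hasFDerivAt).comp θ h2
    exact (DFunLike.congr_fun h3.fderiv (Pi.single j 1)).symm

theorem mul_exp_le_of_forall_mul_pow_le {a x C M : ℝ} (hM : 0 < M)
    (h : ∀ m : ℕ, x ^ m * a ≤ C * m ! * M ^ m) :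
    a * Real.exp (x / (2 * M)) ≤ 2 * C := by
  have h1 : HasSum (fun m : ℕ => a * ((x / (2 * M)) ^ m / m !)) (a * Real.exp (x / (2 * M))) := by
    rw [Real.exp_eq_exp_ℝ]
    exact (NormedSpace.expSeries_div_hasSum_exp (x / (2 * M))).mul_left a
  have h2 : HasSum (fun m : ℕ => C * (1 / 2 : ℝ) ^ m) (C * 2) := hasSum_geometric_two.mul_left C
  rw [mul_comm 2 C]
  refine hasSum_le (fun m => ?_) h1 h2
  have hm : (0 : ℝ) < m ! := by positivity
  have hp : 0 < (2 * M) ^ m := by positivity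
  rw [div_pow, div_div, mul_div_assoc', div_le_iff₀ (by positivity)]
  calc a * x ^ m = x ^ m * a := mul_comm _ _
    _ ≤ C * m ! * M ^ m := h m
    _ = C * (1 / 2 : ℝ) ^ m * ((2 * M) ^ m * m !) := by
      rw [mul_pow, one_div, inv_pow]; field_simp

/-- Fourier coefficients of a periodic real analytic function decay exponentially. -/
theorem exists_norm_cubeCoeff_le_exp {n : ℕ} {f : (Fin n → ℝ) → ℂ}
    (hf : ∀ θ, AnalyticAt ℝ f θ)
    (hper : ∀ (θ : Fin n → ℝ) (k : Fin n → ℤ), f (θ + fun i => (k i : ℝ)) = f θ) :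
    ∃ C a : ℝ, 0 < C ∧ 0 < a ∧ ∀ k, ‖cubeCoeff f k‖ ≤ C * Real.exp (-a * ∑ i, |(k i : ℝ)|) := by
  obtain ⟨C, M, hC, hM, hb⟩ := exists_norm_iteratedFDeriv_le_of_periodic hf hper
  have hsm : ContDiff ℝ (⊤ : ℕ∞) f :=
    contDiff_iff_contDiffAt.2 fun θ => (hf θ).contDiffAt
  refine ⟨2 * C, Real.pi / (M * (n + 1)), by positivity, by positivity, fun k => ?_⟩
  have hcoord : ∀ j, ‖cubeCoeff f k‖ * Real.exp (2 * Real.pi * |(k j : ℝ)| / (2 * M)) ≤ 2 * C := by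
    intro j
    refine mul_exp_le_of_forall_mul_pow_le hM fun m => ?_
    have h1 := norm_cubeCoeff_le (C := C * m ! * M ^ m)
      (f := fun θ => iteratedFDeriv ℝ m f θ (fun _ => Pi.single j 1)) (fun θ => by
        simpa [Pi.norm_single] using hb θ m (Pi.single j 1)) k
    rw [cubeCoeff_iteratedFDeriv hsm hper, norm_mul, norm_pow] at h1
    simpa [abs_of_pos Real.pi_pos] using h1
  have h0 : ‖cubeCoeff f k‖ ≤ C := norm_cubeCoeff_le (fun θ => by
    simpa using hb θ 0 0) k
  rw [neg_mul, Real.exp_neg, ← div_eq_mul_inv, le_div_iff₀ (Real.exp_pos _)]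
  have hS0 : 0 ≤ ∑ i, |(k i : ℝ)| := Finset.sum_nonneg fun _ _ => abs_nonneg _
  rcases hS0.eq_or_lt with hS | hS
  · rw [← hS, mul_zero, Real.exp_zero]
    linarith
  · obtain ⟨j, hj⟩ : ∃ j, ∑ i, |(k i : ℝ)| ≤ (n + 1) * |(k j : ℝ)| := by
      by_contra! hcon
      have := Finset.sum_le_sum fun i (_ : i ∈ Finset.univ) => (hcon i).le
      rw [← Finset.mul_sum] at this
      simp only [Finset.sum_const, Finset.card_univ, Fintype.card_fin, nsmul_eq_mul] at this
      linarith
    refine le_trans ?_ (hcoord j)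
    gcongr
    calc Real.pi / (M * (n + 1)) * ∑ i, |(k i : ℝ)|
        ≤ Real.pi / (M * (n + 1)) * ((n + 1) * |(k j : ℝ)|) := by gcongr
      _ = 2 * Real.pi * |(k j : ℝ)| / (2 * M) := by field_simp

theorem rpow_le_const_mul_exp {σ ε x : ℝ} (hσ : 0 < σ) (hε : 0 < ε) (hx : 0 ≤ x) :
    x ^ σ ≤ (σ / ε) ^ σ * Real.exp (ε * x) := by
  have h1 : x = σ / ε * (ε * x / σ) := by field_simp
  have hy : 0 ≤ ε * x / σ := by positivity
  conv_lhs => rw [h1]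
  rw [Real.mul_rpow (by positivity) hy]
  gcongr
  calc (ε * x / σ) ^ σ ≤ (Real.exp (ε * x / σ)) ^ σ := by
        gcongr
        linarith [Real.add_one_le_exp (ε * x / σ)]
    _ = Real.exp (ε * x) := by
      rw [← Real.exp_mul]; congr 1; field_simp

theorem analyticAt_fourierSeries {n : ℕ} {c : (Fin n → ℤ) → ℂ} {C a : ℝ} (ha : 0 < a)
    (hc : ∀ k, ‖c k‖ ≤ C * Real.exp (-a * ∑ i, |(k i : ℝ)|)) (θ : Fin n → ℝ) :
    AnalyticAt ℝ (fun x => ∑' k, c k * Complex.exp (phase k x)) θ := by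
  have hr : 0 < a / (4 * Real.pi) := by positivity
  have h0 := analyticAt_tsum_mul_exp (c := fun k => c k * Complex.exp (phase k θ)) (L := phase)
    (r := (a / (4 * Real.pi)).toNNReal) (Real.toNNReal_pos.2 hr) (by
      refine Summable.of_nonneg_of_le (fun k => by positivity) (fun k => ?_)
        ((summable_exp_neg_mul_sum_abs (half_pos ha) n).mul_left C)
      rw [norm_mul, norm_exp_phase, mul_one, Real.coe_toNNReal _ hr.le]
      have h2 : a / (4 * Real.pi) * ‖phase k‖ ≤ a / 2 * ∑ i, |(k i : ℝ)| := by
        calc a / (4 * Real.pi) * ‖phase k‖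
            ≤ a / (4 * Real.pi) * (2 * Real.pi * ∑ i, |(k i : ℝ)|) := by
              gcongr; exact norm_phase_le k
          _ = _ := by field_simp; ring
      calc ‖c k‖ * Real.exp (a / (4 * Real.pi) * ‖phase k‖)
          ≤ C * Real.exp (-a * ∑ i, |(k i : ℝ)|) * Real.exp (a / 2 * ∑ i, |(k i : ℝ)|) := by
            gcongr
            · exact (norm_nonneg _).trans (hc k)
            · exact hc k
        _ = C * Real.exp (-(a / 2) * ∑ i, |(k i : ℝ)|) := by
            rw [mul_assoc, ← Real.exp_add]; congr 2; ring)
  have hsub : AnalyticAt ℝ (fun x : Fin n → ℝ => x - θ) θ := analyticAt_id.sub analyticAt_const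
  refine (AnalyticAt.fun_comp_of_eq h0 hsub (sub_self θ)).congr
    (.of_forall fun x => tsum_congr fun k => ?_)
  rw [mul_assoc, ← Complex.exp_add, ← map_add, add_sub_cancel]

/-- The cohomological equation `∂_ω b = f - avg f` for a periodic real analytic `f` and
Diophantine `ω`. -/
theorem exists_analytic_periodic_fderiv_eq {n : ℕ} {γ σ : ℝ} (hγ : 0 < γ) (hσ : 0 < σ)
    {ω : Fin n → ℝ} (hω : IsDiophantine γ σ ω) {f : (Fin n → ℝ) → ℝ}
    (hf : ∀ θ, AnalyticAt ℝ f θ)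
    (hper : ∀ (θ : Fin n → ℝ) (k : Fin n → ℤ), f (θ + fun i => (k i : ℝ)) = f θ) :
    ∃ (b : (Fin n → ℝ) → ℝ) (a : ℝ), (∀ θ, AnalyticAt ℝ b θ) ∧
      (∀ (θ : Fin n → ℝ) (k : Fin n → ℤ), b (θ + fun i => (k i : ℝ)) = b θ) ∧
      ∀ θ, fderiv ℝ b θ ω = f θ - a := by
  have hfc : ∀ θ, AnalyticAt ℝ (fun θ => (f θ : ℂ)) θ := fun θ =>
    (Complex.ofRealCLM.analyticAt _).fun_comp (hf θ)
  have hperc : ∀ (θ : Fin n → ℝ) (k : Fin n → ℤ),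
      ((f (θ + fun i => (k i : ℝ)) : ℝ) : ℂ) = f θ := fun θ k => by rw [hper]
  obtain ⟨C, a, hC, ha, hdec⟩ := exists_norm_cubeCoeff_le_exp hfc hperc
  set fc : (Fin n → ℤ) → ℂ := cubeCoeff (fun θ => (f θ : ℂ)) with hfc_def
  -- the Fourier series of `f`
  have hsumm : Summable fc := Summable.of_norm_bounded
    ((summable_exp_neg_mul_sum_abs ha n).mul_left C) hdec
  obtain ⟨F, hF⟩ := exists_torus_lift (f := fun θ => (f θ : ℂ))
    (continuous_iff_continuousAt.2 fun θ => (hfc θ).continuousAt) hperc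
  have hcoef : UnitAddTorus.mFourierCoeff F = fc := funext fun k => mFourierCoeff_eq_cubeCoeff hF k
  have hseries : ∀ θ, HasSum (fun k => fc k * Complex.exp (phase k θ)) (f θ : ℂ) := by
    intro θ
    have := UnitAddTorus.hasSum_mFourier_series_apply_of_summable (f := F) (by rwa [hcoef])
      (fun i => (θ i : UnitAddCircle))
    rw [hcoef, hF] at this
    simpa only [mFourier_coe, smul_eq_mul] using this
  -- the coefficients of the solution
  let c : (Fin n → ℤ) → ℂ := fun k => if k = 0 then 0 else fc k / phase k ω
  have hphase : ∀ k : Fin n → ℤ, ‖phase k ω‖ = 2 * Real.pi * |∑ i, (k i : ℝ) * ω i| := by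
    intro k
    rw [phase_apply]
    simp [abs_of_pos Real.pi_pos, -Complex.ofReal_sum, Complex.norm_real]
  have hSpos : ∀ k : Fin n → ℤ, k ≠ 0 → 0 < ∑ i, |(k i : ℝ)| := by
    intro k hk
    obtain ⟨i, hi⟩ := Function.ne_iff.1 hk
    exact Finset.sum_pos' (fun _ _ => abs_nonneg _)
      ⟨i, Finset.mem_univ i, abs_pos.2 (by exact_mod_cast hi)⟩
  have hlow : ∀ k : Fin n → ℤ, k ≠ 0 → γ * (∑ i, |(k i : ℝ)|) ^ (-σ) ≤ ‖phase k ω‖ := by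
    intro k hk
    rw [hphase]
    refine (hω k hk).trans (le_mul_of_one_le_left (abs_nonneg _) ?_)
    linarith [Real.pi_gt_three]
  have hne : ∀ k : Fin n → ℤ, k ≠ 0 → phase k ω ≠ 0 := fun k hk => by
    rw [← norm_pos_iff]
    exact (mul_pos hγ (Real.rpow_pos_of_pos (hSpos k hk) _)).trans_le (hlow k hk)
  have hc : ∀ k, ‖c k‖ ≤ C / γ * (σ / (a / 2)) ^ σ * Real.exp (-(a / 2) * ∑ i, |(k i : ℝ)|) := by
    intro k
    by_cases hk : k = 0
    · simp only [c, hk, if_true, norm_zero]; positivity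
    · simp only [c, hk, if_false, norm_div]
      have hS := hSpos k hk
      have h2 := hlow k hk
      have h3 := rpow_le_const_mul_exp hσ (half_pos ha) hS.le
      set S := ∑ i, |(k i : ℝ)|
      calc ‖fc k‖ / ‖phase k ω‖ ≤ C * Real.exp (-a * S) / (γ * S ^ (-σ)) := by
            gcongr
            exact hdec k
        _ = C / γ * Real.exp (-a * S) * S ^ σ := by
            rw [Real.rpow_neg hS.le]; field_simp
        _ ≤ C / γ * Real.exp (-a * S) * ((σ / (a / 2)) ^ σ * Real.exp (a / 2 * S)) := by gcongr
        _ = C / γ * (σ / (a / 2)) ^ σ * (Real.exp (-a * S) * Real.exp (a / 2 * S)) := by ring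
        _ = _ := by rw [← Real.exp_add]; congr 2; ring
  set C' := C / γ * (σ / (a / 2)) ^ σ
  have han := analyticAt_fourierSeries (half_pos ha) hc
  have hcs : Summable c := Summable.of_norm_bounded
    ((summable_exp_neg_mul_sum_abs (half_pos ha) n).mul_left C') hc
  set b : (Fin n → ℝ) → ℂ := fun x => ∑' k, c k * Complex.exp (phase k x) with hb
  -- termwise differentiation
  have hu : Summable fun k : Fin n → ℤ =>
      C' * (8 * Real.pi / a) * Real.exp (-(a / 4) * ∑ i, |(k i : ℝ)|) :=
    (summable_exp_neg_mul_sum_abs (by positivity) n).mul_left _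
  have hnorm : ∀ (k : Fin n → ℤ) (x : Fin n → ℝ), ‖(c k * Complex.exp (phase k x)) • phase k‖ ≤
      C' * (8 * Real.pi / a) * Real.exp (-(a / 4) * ∑ i, |(k i : ℝ)|) := by
    intro k x
    rw [norm_smul, norm_mul, norm_exp_phase, mul_one]
    have hS : 0 ≤ ∑ i, |(k i : ℝ)| := Finset.sum_nonneg fun _ _ => abs_nonneg _
    have h1 := norm_phase_le k
    have h2 := hc k
    set S := ∑ i, |(k i : ℝ)|
    have h3 : S ≤ 4 / a * Real.exp (a / 4 * S) := by
      have := Real.add_one_le_exp (a / 4 * S)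
      calc S = 4 / a * (a / 4 * S) := by field_simp
        _ ≤ _ := by gcongr; linarith
    calc ‖c k‖ * ‖phase k‖
        ≤ C' * Real.exp (-(a / 2) * S) * (2 * Real.pi * (4 / a * Real.exp (a / 4 * S))) := by
          gcongr
          exact h1.trans (by gcongr)
      _ = C' * (8 * Real.pi / a) * (Real.exp (-(a / 2) * S) * Real.exp (a / 4 * S)) := by ring
      _ = _ := by rw [← Real.exp_add]; congr 2; ring
  have hderiv : ∀ θ, HasFDerivAt b (∑' k, (c k * Complex.exp (phase k θ)) • phase k) θ := by
    intro θ
    refine hasFDerivAt_tsum (𝕜 := ℝ) hu (fun k x => ?_) hnorm (x₀ := 0) ?_ θ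
    · convert! (((phase k).hasFDerivAt (x := x)).cexp).const_mul (c k) using 1
      rw [smul_smul]
    · simpa using hcs
  have hbω : ∀ θ, fderiv ℝ b θ ω = f θ - fc 0 := by
    intro θ
    rw [(hderiv θ).fderiv]
    have h1 := (Summable.of_norm_bounded hu fun k => hnorm k θ).hasSum.mapL
      (ContinuousLinearMap.apply ℝ ℂ ω)
    refine h1.unique (((hseries θ).sub (hasSum_ite_eq 0 (fc 0))).congr_fun fun k => ?_)
    by_cases hk : k = 0
    · subst hk
      have h0 : phase (0 : Fin n → ℤ) θ = 0 := by simp [phase_apply]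
      simp [c, h0]
    · have := hne k hk
      simp only [c, hk, if_false, ContinuousLinearMap.apply_apply,
        _root_.smul_apply, smul_eq_mul, sub_zero]
      field_simp
  refine ⟨fun θ => (b θ).re, (fc 0).re, fun θ => (Complex.reCLM.analyticAt _).fun_comp (han θ),
    fun θ k => ?_, fun θ => ?_⟩
  · simp only [hb, exp_phase_add_int]
  · have h1 := Complex.reCLM.hasFDerivAt.comp θ (hderiv θ)
    have h2 : HasFDerivAt (fun θ => (b θ).re) _ θ := h1
    rw [h2.fderiv, ← (hderiv θ).fderiv, ContinuousLinearMap.comp_apply, hbω θ]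
    simp

theorem analyticAt_fderiv_apply {n : ℕ} {F : Type*} [NormedAddCommGroup F] [NormedSpace ℝ F]
    [CompleteSpace F] {f : (Fin n → ℝ) → F} {θ : Fin n → ℝ} (hf : AnalyticAt ℝ f θ)
    (v : Fin n → ℝ) : AnalyticAt ℝ (fun θ => fderiv ℝ f θ v) θ :=
  (ContinuousLinearMap.apply ℝ F v).analyticAt _ |>.fun_comp hf.fderiv

theorem fderiv_fderiv_apply_comm {n : ℕ} {F : Type*} [NormedAddCommGroup F] [NormedSpace ℝ F]
    [CompleteSpace F] {f : (Fin n → ℝ) → F} {θ : Fin n → ℝ} (hf : AnalyticAt ℝ f θ)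
    (v w : Fin n → ℝ) :
    fderiv ℝ (fun x => fderiv ℝ f x v) θ w = fderiv ℝ (fun x => fderiv ℝ f x w) θ v := by
  have h : ∀ u, HasFDerivAt (fun x => fderiv ℝ f x u)
      ((ContinuousLinearMap.apply ℝ F u).comp (fderiv ℝ (fderiv ℝ f) θ)) θ := fun u =>
    (ContinuousLinearMap.apply ℝ F u).hasFDerivAt.comp θ hf.fderiv.differentiableAt.hasFDerivAt
  rw [(h v).fderiv, (h w).fderiv]
  exact (hf.contDiffAt (n := ⊤)).isSymmSndFDerivAt_of_omega w v

theorem fderiv_pi_apply {n m : ℕ} {f : (Fin n → ℝ) → (Fin m → ℝ)} {θ : Fin n → ℝ}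
    (hf : DifferentiableAt ℝ f θ) (v : Fin n → ℝ) (i : Fin m) :
    fderiv ℝ f θ v i = fderiv ℝ (fun x => f x i) θ v := by
  rw [fderiv_apply hf]; rfl

theorem pjac_mulVec_s18 {n m : ℕ} (f : (Fin n → ℝ) → (Fin m → ℝ)) (θ v : Fin n → ℝ) :
    (pjac f θ).mulVec v = fderiv ℝ f θ v := by
  conv_rhs => rw [← Finset.univ_sum_single v, map_sum]
  funext i
  simp only [Matrix.mulVec, dotProduct, pjac, Matrix.of_apply, Finset.sum_apply]
  refine Finset.sum_congr rfl fun j _ => ?_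
  rw [show (Pi.single j (v j) : Fin n → ℝ) = v j • Pi.single j 1 by
    rw [← Pi.single_smul, smul_eq_mul, mul_one], map_smul, Pi.smul_apply, smul_eq_mul, mul_comm]

theorem fderiv_apply_eq_pgrad_dotProduct {n : ℕ} (f : (Fin n → ℝ) → ℝ) (θ v : Fin n → ℝ) :
    fderiv ℝ f θ v = pgrad f θ ⬝ᵥ v := by
  conv_lhs => rw [← Finset.univ_sum_single v, map_sum]
  refine Finset.sum_congr rfl fun j _ => ?_
  rw [show (Pi.single j (v j) : Fin n → ℝ) = v j • Pi.single j 1 by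
    rw [← Pi.single_smul, smul_eq_mul, mul_one], map_smul, smul_eq_mul, mul_comm]
  rfl

theorem transpose_pjac_mulVec_apply {n m : ℕ} (K : (Fin n → ℝ) → (Fin m → ℝ)) (θ : Fin n → ℝ)
    (v : Fin m → ℝ) (j : Fin n) :
    (pjac K θ)ᵀ.mulVec v j = fderiv ℝ K θ (Pi.single j 1) ⬝ᵥ v := rfl

/-- The exterior derivative of the pulled-back one-form `K^*(c · dz)`. -/
theorem fderiv_pullback_sub {n m : ℕ} {K : (Fin n → ℝ) → (Fin m → ℝ)}
    {c : (Fin m → ℝ) → (Fin m → ℝ)} {θ : Fin n → ℝ} (hK : AnalyticAt ℝ K θ)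
    (hc : AnalyticAt ℝ c (K θ)) (u v : Fin n → ℝ) :
    fderiv ℝ (fun x => fderiv ℝ K x v ⬝ᵥ c (K x)) θ u -
      fderiv ℝ (fun x => fderiv ℝ K x u ⬝ᵥ c (K x)) θ v =
      fderiv ℝ K θ v ⬝ᵥ fderiv ℝ c (K θ) (fderiv ℝ K θ u) -
        fderiv ℝ K θ u ⬝ᵥ fderiv ℝ c (K θ) (fderiv ℝ K θ v) := by
  have h : ∀ p q : Fin n → ℝ, fderiv ℝ (fun x => fderiv ℝ K x p ⬝ᵥ c (K x)) θ q =
      fderiv ℝ (fun x => fderiv ℝ K x p) θ q ⬝ᵥ c (K θ) +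
        fderiv ℝ K θ p ⬝ᵥ fderiv ℝ c (K θ) (fderiv ℝ K θ q) := by
    intro p q
    have h1 := hasFDerivAt_pi'.1 (analyticAt_fderiv_apply hK p).differentiableAt.hasFDerivAt
    have h2 := hasFDerivAt_pi'.1
      (hc.differentiableAt.hasFDerivAt.comp θ hK.differentiableAt.hasFDerivAt)
    have h3 := HasFDerivAt.fun_sum (u := Finset.univ) fun i _ => (h1 i).mul (h2 i)
    have h4 : HasFDerivAt (fun x => fderiv ℝ K x p ⬝ᵥ c (K x)) _ θ := h3
    rw [h4.fderiv]
    simp only [dotProduct, ← Finset.sum_add_distrib]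
    simp [mul_comm, add_comm]
  rw [h, h, fderiv_fderiv_apply_comm hK v u]
  ring

end

/-- For a real analytic `ℤⁿ`-periodic map `K` with error
`e(θ) = B(K(θ))∇H(K(θ)) − ∂_ω K(θ)` (Diophantine `ω`, exact invertible analytic
structure matrix `B`), the pulled-back 1-form decomposes as
`DK(θ)ᵀ c(K(θ)) = ∇b̃(θ) + a₀ + g(θ)` with `g` of zero average and
`∂_ω g(θ) = DK(θ)ᵀ B(K(θ))⁻¹ e(θ)`. -/
theorem stmt_18 {n : ℕ} (U : Set (Fin (2 * n) → ℝ)) (hU : IsOpen U)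
    (B : (Fin (2 * n) → ℝ) → Matrix (Fin (2 * n)) (Fin (2 * n)) ℝ)
    (hB : ∀ z ∈ U, ∀ i j, AnalyticAt ℝ (fun w => B w i j) z)
    (hskew : ∀ z ∈ U, ∀ i j, B z i j = - B z j i)
    (hjacobi : ∀ z ∈ U, ∀ i j k,
      ∑ l, (fderiv ℝ (fun w => B w i j) z (Pi.single l 1) * B z l k
          + fderiv ℝ (fun w => B w j k) z (Pi.single l 1) * B z l i
          + fderiv ℝ (fun w => B w k i) z (Pi.single l 1) * B z l j) = 0)
    (hBunit : ∀ z ∈ U, IsUnit (B z))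
    (H : (Fin (2 * n) → ℝ) → ℝ) (hH : ∀ z ∈ U, AnalyticAt ℝ H z)
    (c : (Fin (2 * n) → ℝ) → (Fin (2 * n) → ℝ)) (hc : ∀ z ∈ U, AnalyticAt ℝ c z)
    (hexact : ∀ z ∈ U, (B z)⁻¹ = (pjac c z)ᵀ - pjac c z)
    (γ σ : ℝ) (hγ : 0 < γ) (hσ : 0 < σ)
    (ω : Fin n → ℝ) (hω : IsDiophantine γ σ ω)
    (K : (Fin n → ℝ) → (Fin (2 * n) → ℝ)) (hK : ∀ θ, AnalyticAt ℝ K θ)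
    (hKU : ∀ θ, K θ ∈ U)
    (hKper : ∀ (θ : Fin n → ℝ) (k : Fin n → ℤ), K (θ + fun i => (k i : ℝ)) = K θ) :
    ∃ (bt : (Fin n → ℝ) → ℝ) (g : (Fin n → ℝ) → (Fin n → ℝ)) (a₀ : Fin n → ℝ),
      (∀ θ, AnalyticAt ℝ bt θ) ∧
      (∀ (θ : Fin n → ℝ) (k : Fin n → ℤ), bt (θ + fun i => (k i : ℝ)) = bt θ) ∧
      (∀ θ, AnalyticAt ℝ g θ) ∧
      (∀ (θ : Fin n → ℝ) (k : Fin n → ℤ), g (θ + fun i => (k i : ℝ)) = g θ) ∧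
      (∫ θ in Set.Icc (0 : Fin n → ℝ) 1, g θ) = 0 ∧
      (∀ θ, (pjac K θ)ᵀ.mulVec (c (K θ)) = pgrad bt θ + a₀ + g θ) ∧
      (∀ θ, fderiv ℝ g θ ω =
        (pjac K θ)ᵀ.mulVec (((B (K θ))⁻¹).mulVec
          ((B (K θ)).mulVec (pgrad H (K θ)) - fderiv ℝ K θ ω))) := by
  have hcK : ∀ θ, AnalyticAt ℝ (fun x => c (K x)) θ := fun θ => (hc _ (hKU θ)).fun_comp (hK θ)
  have hHK : ∀ θ, AnalyticAt ℝ (fun x => H (K x)) θ := fun θ => (hH _ (hKU θ)).fun_comp (hK θ)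
  have hαv : ∀ v θ, AnalyticAt ℝ (fun x => fderiv ℝ K x v ⬝ᵥ c (K x)) θ := fun v θ =>
    Finset.analyticAt_fun_sum _ fun i _ =>
      (analyticAt_pi_iff.1 (analyticAt_fderiv_apply (hK θ) v) i).fun_mul
        (analyticAt_pi_iff.1 (hcK θ) i)
  have hαper : ∀ v (θ : Fin n → ℝ) (k : Fin n → ℤ),
      fderiv ℝ K (θ + fun i => (k i : ℝ)) v ⬝ᵥ c (K (θ + fun i => (k i : ℝ))) =
        fderiv ℝ K θ v ⬝ᵥ c (K θ) := fun v θ k => by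
    rw [fderiv_periodic hKper, hKper]
  obtain ⟨bt, a, hbt, hbtper, hbtω⟩ := exists_analytic_periodic_fderiv_eq hγ hσ hω
    (f := fun x => fderiv ℝ K x ω ⬝ᵥ c (K x) - H (K x)) (fun θ => (hαv ω θ).fun_sub (hHK θ))
    (fun θ k => by rw [hαper, hKper])
  let α : (Fin n → ℝ) → (Fin n → ℝ) := fun θ => (pjac K θ)ᵀ.mulVec (c (K θ))
  have hα : ∀ θ, AnalyticAt ℝ α θ := fun θ => AnalyticAt.pi fun j => hαv (Pi.single j 1) θ
  have hgrad : ∀ θ, AnalyticAt ℝ (pgrad bt) θ := fun θ =>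
    AnalyticAt.pi fun j => analyticAt_fderiv_apply (hbt θ) (Pi.single j 1)
  have hα_cont : Continuous α := continuous_iff_continuousAt.2 fun θ => (hα θ).continuousAt
  have hgrad_cont : Continuous (pgrad bt) :=
    continuous_iff_continuousAt.2 fun θ => (hgrad θ).continuousAt
  have hcontint : ∀ {f : (Fin n → ℝ) → (Fin n → ℝ)}, Continuous f →
      IntegrableOn f (Set.Icc (0 : Fin n → ℝ) 1) := fun hf =>
    hf.continuousOn.integrableOn_compact isCompact_Icc
  let a₀ : Fin n → ℝ := ∫ θ in Set.Icc (0 : Fin n → ℝ) 1, α θ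
  refine ⟨bt, fun θ => α θ - a₀ - pgrad bt θ, a₀, hbt, hbtper,
    fun θ => ((hα θ).fun_sub analyticAt_const).fun_sub (hgrad θ), fun θ k => ?_, ?_, fun θ => ?_,
    fun θ => ?_⟩
  · have h1 : α (θ + fun i => (k i : ℝ)) = α θ := funext fun j => hαper (Pi.single j 1) θ k
    have h2 : pgrad bt (θ + fun i => (k i : ℝ)) = pgrad bt θ := by
      funext j
      simp only [pgrad, fderiv_periodic hbtper]
    simp only [h1, h2]
  · have hgrad0 : ∫ θ in Set.Icc (0 : Fin n → ℝ) 1, pgrad bt θ = 0 := by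
      funext j
      rw [eval_integral fun i => (hcontint hgrad_cont).eval i]
      exact integral_fderiv_single_eq_zero
        (contDiff_iff_contDiffAt.2 fun θ => (hbt θ).contDiffAt) hbtper j
    have hvol : volume.real (Set.Icc (0 : Fin n → ℝ) 1) = 1 := by
      simp [measureReal_def, Real.volume_Icc_pi]
    have hconst : IntegrableOn (fun _ => a₀) (Set.Icc (0 : Fin n → ℝ) 1) := hcontint continuous_const
    change ∫ θ in Set.Icc (0 : Fin n → ℝ) 1, (α θ - a₀ - pgrad bt θ) = 0
    rw [integral_sub (f := fun θ => α θ - a₀) ((hcontint hα_cont).sub hconst) (hcontint hgrad_cont),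
      integral_sub (hcontint hα_cont) hconst, hgrad0, setIntegral_const, hvol, one_smul, sub_zero,
      sub_self]
  · change α θ = pgrad bt θ + a₀ + (α θ - a₀ - pgrad bt θ)
    abel
  · funext j
    have hg := (((hα θ).fun_sub (analyticAt_const (v := a₀))).fun_sub (hgrad θ)).differentiableAt
    have hgj : fderiv ℝ (fun θ => α θ - a₀ - pgrad bt θ) θ ω j =
        fderiv ℝ (fun x => fderiv ℝ K x (Pi.single j 1) ⬝ᵥ c (K x)) θ ω -
          fderiv ℝ (fun x => fderiv ℝ bt x (Pi.single j 1)) θ ω := by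
      have h1 := (hαv (Pi.single j 1) θ).differentiableAt
      have h2 := (analyticAt_fderiv_apply (hbt θ) (Pi.single j 1)).differentiableAt
      rw [fderiv_pi_apply hg]
      have h3 := ((h1.hasFDerivAt.sub_const (a₀ j)).fun_sub h2.hasFDerivAt).fderiv
      exact DFunLike.congr_fun h3 ω
    have hmixed : fderiv ℝ (fun x => fderiv ℝ bt x (Pi.single j 1)) θ ω =
        fderiv ℝ (fun x => fderiv ℝ K x ω ⬝ᵥ c (K x)) θ (Pi.single j 1) -
          pgrad H (K θ) ⬝ᵥ fderiv ℝ K θ (Pi.single j 1) := by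
      rw [fderiv_fderiv_apply_comm (hbt θ), funext hbtω, ← fderiv_apply_eq_pgrad_dotProduct]
      have h1 := (hH _ (hKU θ)).differentiableAt.hasFDerivAt.comp θ
        (hK θ).differentiableAt.hasFDerivAt
      have h2 := (((hαv ω θ).differentiableAt.hasFDerivAt.fun_sub h1).sub_const a).fderiv
      exact DFunLike.congr_fun h2 (Pi.single j 1)
    have hinv : (B (K θ))⁻¹ * B (K θ) = 1 :=
      nonsing_inv_mul _ ((isUnit_iff_isUnit_det _).1 (hBunit _ (hKU θ)))
    rw [hgj, hmixed, transpose_pjac_mulVec_apply, mulVec_sub, mulVec_mulVec, hinv, one_mulVec,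
      hexact _ (hKU θ), sub_mulVec, pjac_mulVec_s18, dotProduct_sub, dotProduct_sub,
      mulVec_transpose, dotProduct_comm _ (vecMul _ _), ← dotProduct_mulVec, pjac_mulVec_s18,
      dotProduct_comm (pgrad H (K θ))]
    linear_combination fderiv_pullback_sub (hK θ) (hc _ (hKU θ)) ω (Pi.single j 1)
end
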